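/- Let $r\ge 3$ be an integer, let $\varepsilon>0$ be a sufficiently small constant, let $d^*=\lceil\varepsilon^2\log n\rceil$, let $p=(1+\varepsilon)\log n/\binom{n-1}{r-1}$, and let $\rho\ge 1$ be a fixed integer. Then for each $n$ there exists a probability space carrying random hypergraphs $H,\hat\Gamma_1,\dots,\hat\Gamma_\rho$ on vertex set $[n]$ such that: $H$ is distributed as $H_{n,p}$; $\hat\Gamma_1,\dots,\hat\Gamma_\rho$ are mutually independent, each distributed as $\hat H_{n,d^*}$; and the probability that every edge of every $\hat\Gamma_i$ is an edge of $H$ tends to $1$ as $n\to\infty$. -/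

import Mathlib

open MeasureTheory
open scoped Classical ENNReal

/-- We equip `Finset (Fin n)` (and hence all the finite types built from it below) with
the discrete σ-algebra. -/
instance {n : ℕ} : MeasurableSpace (Finset (Fin n)) := ⊤

/-- An (unoriented) edge of an `r`-uniform hypergraph on `Fin n`:
an `r`-element subset of `Fin n`. -/
abbrev Edge (r n : ℕ) := {e : Finset (Fin n) // e.card = r}

/-- The outcome space of the random hypergraph `Ĥ_{n,d}`: every vertex `v : Fin n`
picks (uniformly, independently, with replacement) `d` edges containing `v`. -/
abbrev Picks (r n d : ℕ) :=
  ∀ v : Fin n, Fin d → {e : Finset (Fin n) // e.card = r ∧ v ∈ e}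

/-- The uniform probability measure on the outcome space of `Ĥ_{n,d}` (all picks
uniform and independent): normalized counting measure. -/
noncomputable def uniformPicks (r n d : ℕ) : Measure (Picks r n d) :=
  (Fintype.card (Picks r n d) : ℝ≥0∞)⁻¹ • Measure.count

/-- The Bernoulli measure on `Bool` with success probability `q`. -/
noncomputable def bern (q : ℝ≥0∞) : Measure Bool :=
  q • Measure.dirac true + (1 - q) • Measure.dirac false
/-- uniform law on a finset -/
noncomputable def unifF {E : Type*} [MeasurableSpace E] (A : Finset E) : Measure E :=
  (A.card : ℝ≥0∞)⁻¹ • (Measure.count.restrict (A : Set E))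

set_option linter.all false
section Part1
variable {E : Type*} [Fintype E] [MeasurableSpace E] [DiscreteMeasurableSpace E]

lemma unifF_singleton (A : Finset E) (e : E) :
    unifF A {e} = if e ∈ A then (A.card : ℝ≥0∞)⁻¹ else 0 := by
  rw [unifF, Measure.smul_apply, Measure.restrict_apply (MeasurableSet.of_discrete)]
  split_ifs with h
  · rw [Set.inter_eq_left.2 (by simpa using h)]; simp
  · rw [Set.singleton_inter_eq_empty.2 (by simpa using h)]; simp

lemma unifF_apply (A B : Finset E) :
    unifF A (B : Set E) = ((A.card : ℝ≥0∞)⁻¹ * ((B ∩ A).card : ℝ≥0∞)) := by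
  rw [unifF, Measure.smul_apply, Measure.restrict_apply (MeasurableSet.of_discrete),
    ← Finset.coe_inter, Measure.count_apply_finset, smul_eq_mul]

lemma unifF_prob (A : Finset E) (hA : A.Nonempty) : IsProbabilityMeasure (unifF A) := by
  constructor
  have := unifF_apply A Finset.univ
  rw [Finset.coe_univ] at this
  rw [this, Finset.univ_inter, ENNReal.inv_mul_cancel]
  · simpa using hA.ne_empty
  · simp

instance (A : Finset E) : IsFiniteMeasure (unifF A) := by
  rcases A.eq_empty_or_nonempty with rfl | h
  · simp only [unifF, Finset.coe_empty, Measure.restrict_empty, smul_zero]; infer_instance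
  · have := unifF_prob A h; infer_instance

lemma unifF_compl (A : Finset E) : unifF A {e | e ∉ A} = 0 := by
  rw [unifF, Measure.smul_apply, Measure.restrict_apply (MeasurableSet.of_discrete)]
  have : {e | e ∉ A} ∩ (A : Set E) = ∅ := by ext; simp
  simp [this]

instance (q : ℝ≥0∞) : SFinite (bern q) := by unfold bern; infer_instance

lemma bern_prob (q : ℝ≥0∞) (hq : q ≤ 1) : IsProbabilityMeasure (bern q) := by
  constructor
  simp [bern, add_tsub_cancel_of_le hq]

lemma bern_false (q : ℝ≥0∞) : bern q {false} = 1 - q := by simp [bern]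
lemma bern_true (q : ℝ≥0∞) : bern q {true} = q := by simp [bern]

open Equiv in
lemma averaging {Y : Type*} [MeasurableSpace Y] [Countable Y] [DiscreteMeasurableSpace Y]
    (A : Finset E) (μ : Measure (E → Bool)) (ν : Measure Y) [IsFiniteMeasure μ] [IsFiniteMeasure ν]
    (hμ : ∀ σ : Perm A, MeasurePreserving (fun x : E → Bool => x ∘ (Perm.ofSubtype σ)) μ μ)
    (act : Perm A → Y → Y) (hν : ∀ σ, MeasurePreserving (act σ) ν ν)
    (π0 : Measure ((E → Bool) × Y)) [IsFiniteMeasure π0]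
    (h1 : π0.map Prod.fst = μ) (h2 : π0.map Prod.snd = ν)
    (τ : (E → Bool) × Y → Perm A)
    (bad : Set ((E → Bool) × Y))
    (hbad : ∀ σ x y, (x ∘ (Perm.ofSubtype σ⁻¹), act σ y) ∈ bad → (x, y) ∈ bad) :
    ∃ π : Measure ((E → Bool) × Y), IsFiniteMeasure π ∧ π.map Prod.fst = μ ∧
      π.map Prod.snd = ν ∧ π bad ≤ π0 {z | (z.1 ∘ (Perm.ofSubtype (τ z)), z.2) ∈ bad} := by
  let _ : MeasurableSpace (Perm A) := ⊤
  have : DiscreteMeasurableSpace (Perm A) := ⟨fun _ => trivial⟩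
  let γ : Measure (Perm A) := (Fintype.card (Perm A) : ℝ≥0∞)⁻¹ • Measure.count
  have : IsProbabilityMeasure γ := by
    constructor
    simp only [γ, Measure.smul_apply, smul_eq_mul, Measure.count_univ, ENat.card_eq_coe_fintype_card]
    simp only [ENat.toENNReal_coe]
    apply ENNReal.inv_mul_cancel
    · simpa using Fintype.card_ne_zero (α := Perm A)
    · simp
  have hγ : ∀ τ : Perm A, γ.map (fun σ => σ * τ) = γ := by
    intro τ
    apply Measure.ext_of_singleton
    intro a
    rw [Measure.map_apply .of_discrete .of_discrete]
    have : (fun σ => σ * τ) ⁻¹' {a} = {a * τ⁻¹} := by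
      ext s; simp [eq_mul_inv_iff_mul_eq]
    rw [this]; simp [γ]
  let Z : ((E → Bool) × Y) × Perm A → (E → Bool) × Y :=
    fun p => ((p.1.1 ∘ Perm.ofSubtype (τ p.1)) ∘ Perm.ofSubtype p.2⁻¹, act p.2 p.1.2)
  have m1 : MeasurePreserving (Prod.fst : (E → Bool) × Y → _) π0 μ := ⟨measurable_fst, h1⟩
  have m2 : MeasurePreserving (Prod.snd : (E → Bool) × Y → _) π0 ν := ⟨measurable_snd, h2⟩
  refine ⟨(π0.prod γ).map Z, inferInstance, ?_, ?_, ?_⟩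
  · rw [Measure.map_map .of_discrete .of_discrete]
    have s1 : MeasurePreserving (fun p : ((E → Bool) × Y) × Perm A => (p.1.1, p.2 * (τ p.1)⁻¹))
        (π0.prod γ) (μ.prod γ) :=
      m1.skew_product (g := fun z σ => σ * (τ z)⁻¹) .of_discrete (ae_of_all _ fun z => hγ _)
    have s2 : MeasurePreserving (Prod.swap) (μ.prod γ) (γ.prod μ) := Measure.measurePreserving_swap
    have s3 : MeasurePreserving (fun p : Perm A × (E → Bool) => (p.1, p.2 ∘ Perm.ofSubtype p.1⁻¹))
        (γ.prod μ) (γ.prod μ) :=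
      (MeasurePreserving.id γ).skew_product (g := fun σ x => x ∘ Perm.ofSubtype σ⁻¹) .of_discrete
        (ae_of_all _ fun z => (hμ _).map_eq)
    have s4 : MeasurePreserving (Prod.snd) (γ.prod μ) μ := measurePreserving_snd
    convert (s4.comp (s3.comp (s2.comp s1))).map_eq using 2
    ext p e
    simp [Z]
    rfl
  · rw [Measure.map_map .of_discrete .of_discrete]
    have s1 : MeasurePreserving (fun p : ((E → Bool) × Y) × Perm A => (p.1.2, p.2))
        (π0.prod γ) (ν.prod γ) := m2.prod (MeasurePreserving.id γ)
    have s2 : MeasurePreserving (Prod.swap) (ν.prod γ) (γ.prod ν) := Measure.measurePreserving_swap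
    have s3 : MeasurePreserving (fun p : Perm A × Y => (p.1, act p.1 p.2))
        (γ.prod ν) (γ.prod ν) :=
      (MeasurePreserving.id γ).skew_product (g := fun σ x => act σ x) .of_discrete
        (ae_of_all _ fun z => (hν _).map_eq)
    have s4 : MeasurePreserving (Prod.snd) (γ.prod ν) ν := measurePreserving_snd
    exact (s4.comp (s3.comp (s2.comp s1))).map_eq
  · rw [Measure.map_apply .of_discrete .of_discrete]
    calc (π0.prod γ) (Z ⁻¹' bad)
        ≤ (π0.prod γ) ({z | (z.1 ∘ (Perm.ofSubtype (τ z)), z.2) ∈ bad} ×ˢ Set.univ) := by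
          apply measure_mono
          rintro ⟨z, σ⟩ h
          exact ⟨hbad σ _ _ h, trivial⟩
      _ = _ := by rw [Measure.prod_prod]; simp

lemma bernpi_inv (q : ℝ≥0∞) (hq : q ≤ 1) (σ : Equiv.Perm E) :
    MeasurePreserving (fun x : E → Bool => x ∘ σ) (Measure.pi fun _ : E => bern q)
      (Measure.pi fun _ : E => bern q) := by
  have := bern_prob q hq
  refine ⟨.of_discrete, ?_⟩
  apply Measure.ext_of_singleton
  intro a
  rw [Measure.map_apply .of_discrete .of_discrete]
  have : (fun x : E → Bool => x ∘ σ) ⁻¹' {a} = {a ∘ σ.symm} := by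
    ext x
    simp only [Set.mem_preimage, Set.mem_singleton_iff]
    exact ⟨fun h => by rw [← h]; ext; simp, fun h => by rw [h]; ext; simp⟩
  rw [this, Measure.pi_singleton, Measure.pi_singleton]
  exact Fintype.prod_equiv σ.symm _ _ (fun _ => rfl)

end Part1

section Part2
variable {E : Type*} [Fintype E] [MeasurableSpace E] [DiscreteMeasurableSpace E]

lemma unifF_inv (A : Finset E) (s : Equiv.Perm E) (hs : ∀ e, s e ∈ A ↔ e ∈ A) :
    MeasurePreserving s (unifF A) (unifF A) := by
  refine ⟨.of_discrete, ?_⟩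
  apply Measure.ext_of_singleton
  intro a
  rw [Measure.map_apply .of_discrete .of_discrete]
  have : s ⁻¹' {a} = {s.symm a} := by
    ext x
    simp [Equiv.eq_symm_apply]
  rw [this, unifF_singleton, unifF_singleton]
  have := hs (s.symm a)
  simp at this
  simp [this]

lemma ofSubtype_mem {F A : Finset E} (hFA : F ⊆ A) (σ : Equiv.Perm F) (e : E) :
    Equiv.Perm.ofSubtype σ e ∈ A ↔ e ∈ A := by
  by_cases h : e ∈ F
  · rw [Equiv.Perm.ofSubtype_apply_of_mem _ h]
    exact ⟨fun _ => hFA h, fun _ => hFA (σ _).2⟩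
  · rw [Equiv.Perm.ofSubtype_apply_of_not_mem _ h]

lemma unifF_pi_inv {J : Type*} [Fintype J] (A : Finset E) (s : Equiv.Perm E)
    (hs : ∀ e, s e ∈ A ↔ e ∈ A) :
    MeasurePreserving (fun f : J → E => s ∘ f) (Measure.pi fun _ : J => unifF A)
      (Measure.pi fun _ : J => unifF A) := by
  refine ⟨.of_discrete, ?_⟩
  have h := (unifF_inv A s hs).map_eq
  have := Measure.pi_map_pi (μ := fun _ : J => unifF A) (f := fun _ : J => s)
    (fun _ => Measurable.of_discrete.aemeasurable)
  rw [h] at this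
  exact this

lemma pi_unif_null {J : Type*} [Fintype J] (A : Finset E) :
    (Measure.pi fun _ : J => unifF A) {f | ¬ ∀ j, f j ∈ A} = 0 := by
  have : {f : J → E | ¬ ∀ j, f j ∈ A} = ⋃ j, {f | f j ∉ A} := by ext; simp
  rw [this, measure_iUnion_null_iff]
  intro j
  exact Measure.pi_eval_preimage_null (fun _ : J => unifF A) (unifF_compl A)

lemma exists_tau {J : Type*} [Fintype J] (A : Finset E) (x : E → Bool) (f : J → E)
    (hf : ∀ j, f j ∈ A) (hx : Fintype.card J ≤ (A.filter (fun e => x e = true)).card) :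
    ∃ σ : Equiv.Perm A, ∀ j, x (Equiv.Perm.ofSubtype σ (f j)) = true := by
  let I : Finset A := Finset.univ.image (fun j => (⟨f j, hf j⟩ : A))
  have hI : Fintype.card I ≤ Fintype.card {e // e ∈ A.filter (fun e => x e = true)} := by
    simp only [Fintype.card_coe]
    exact (Finset.card_image_le).trans (by simpa using hx)
  obtain ⟨g⟩ := Function.Embedding.nonempty_of_card_le hI
  obtain ⟨σ, hσ⟩ := Equiv.Perm.exists_extending_pair (fun i : I => i.1)
    (fun i : I => (⟨(g i).1, (Finset.mem_filter.1 (g i).2).1⟩ : A)) Subtype.val_injective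
    (fun a b h => g.injective (Subtype.ext (congrArg (fun z : A => z.1) h)))
  refine ⟨σ, fun j => ?_⟩
  rw [Equiv.Perm.ofSubtype_apply_of_mem _ (hf j)]
  rw [hσ ⟨⟨f j, hf j⟩, by simp [I]⟩]
  exact (Finset.mem_filter.1 (g _).2).2

lemma coupL1 {J : Type*} [Fintype J] (A : Finset E) (hA : A.Nonempty)
    (μ : Measure (E → Bool)) [IsFiniteMeasure μ]
    (hμ : ∀ σ : Equiv.Perm A,
      MeasurePreserving (fun x : E → Bool => x ∘ (Equiv.Perm.ofSubtype σ)) μ μ) :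
    ∃ π : Measure ((E → Bool) × (J → E)), IsFiniteMeasure π ∧ π.map Prod.fst = μ ∧
      π.map Prod.snd = μ Set.univ • Measure.pi (fun _ : J => unifF A) ∧
      π {z | ¬ ∀ j, z.1 (z.2 j) = true} ≤
        μ {x | (A.filter (fun e => x e = true)).card < Fintype.card J} := by
  have hp := unifF_prob A hA
  let ν0 : Measure (J → E) := Measure.pi (fun _ : J => unifF A)
  have hc : ∀ z : (E → Bool) × (J → E), ∃ σ : Equiv.Perm A, (∀ j, z.2 j ∈ A) →
      Fintype.card J ≤ (A.filter (fun e => z.1 e = true)).card →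
      ∀ j, z.1 (Equiv.Perm.ofSubtype σ (z.2 j)) = true := by
    intro z
    by_cases h1 : ∀ j, z.2 j ∈ A
    · by_cases h2 : Fintype.card J ≤ (A.filter (fun e => z.1 e = true)).card
      · obtain ⟨σ, hσ⟩ := exists_tau A z.1 z.2 h1 h2
        exact ⟨σ, fun _ _ => hσ⟩
      · exact ⟨1, fun _ h => absurd h h2⟩
    · exact ⟨1, fun h => absurd h h1⟩
  choose τ hτ using hc
  have fin : IsFiniteMeasure (μ Set.univ • ν0) := Measure.smul_finite _ (measure_ne_top _ _)
  obtain ⟨π, hπ, h1, h2, h3⟩ := averaging A μ (μ Set.univ • ν0) hμ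
    (fun σ f => Equiv.Perm.ofSubtype σ ∘ f)
    (fun σ => (unifF_pi_inv A (Equiv.Perm.ofSubtype σ)
      (ofSubtype_mem subset_rfl σ)).smul_measure _) (μ.prod ν0)
    (by rw [Measure.map_fst_prod]; simp) (by rw [Measure.map_snd_prod]) τ
    {z | ¬ ∀ j, z.1 (z.2 j) = true} (by
      intro σ x y h
      simpa using h)
  refine ⟨π, hπ, h1, h2, h3.trans ?_⟩
  calc (μ.prod ν0) _ ≤ (μ.prod ν0) (({x | (A.filter (fun e => x e = true)).card < Fintype.card J}
        ×ˢ Set.univ) ∪ (Set.univ ×ˢ {f | ¬ ∀ j, f j ∈ A})) := by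
        apply measure_mono
        rintro z hz
        by_contra hcon
        simp only [Set.mem_union, Set.mem_prod, Set.mem_setOf_eq, Set.mem_univ, and_true,
          true_and, not_or, not_not, not_lt] at hcon
        exact hz (hτ z hcon.2 hcon.1)
    _ ≤ _ := measure_union_le _ _
    _ ≤ _ := by
      rw [Measure.prod_prod, Measure.prod_prod, pi_unif_null]
      simp [ν0]

lemma coupQP {X Y : Type*} [MeasurableSpace X] [Countable X] [DiscreteMeasurableSpace X]
    [MeasurableSpace Y] [Countable Y] [DiscreteMeasurableSpace Y]
    (μ : Measure X) (ν : Measure Y) [IsProbabilityMeasure μ] [IsProbabilityMeasure ν]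
    (P : Set X) (Q : Set Y) (h : ν Q ≤ μ P) :
    ∃ π : Measure (X × Y), IsFiniteMeasure π ∧ π.map Prod.fst = μ ∧ π.map Prod.snd = ν ∧
      π {z | z.2 ∈ Q ∧ z.1 ∉ P} = 0 := by
  have mP : MeasurableSet P := .of_discrete
  have mQ : MeasurableSet Q := .of_discrete
  by_cases hQ : ν Q = 0
  · refine ⟨μ.prod ν, inferInstance, by rw [Measure.map_fst_prod]; simp,
      by rw [Measure.map_snd_prod]; simp, ?_⟩
    refine measure_mono_null (t := Set.univ ×ˢ Q) ?_ ?_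
    · rintro z hz; exact ⟨trivial, hz.1⟩
    · rw [Measure.prod_prod, hQ]; simp
  have hP : μ P ≠ 0 := fun h0 => hQ (le_antisymm (h.trans h0.le) bot_le)
  have hPt := measure_ne_top μ P
  have hQt := measure_ne_top ν Q
  have hle : ν Q / μ P ≤ 1 := ENNReal.div_le_of_le_mul (by simpa using h)
  let μ' : Measure X := μ.restrict Pᶜ + (1 - ν Q / μ P) • μ.restrict P
  have fin1 : IsFiniteMeasure ((1 - ν Q / μ P) • μ.restrict P) :=
    Measure.smul_finite _ (ne_top_of_le_ne_top ENNReal.one_ne_top tsub_le_self)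
  have hsum : (ν Q / μ P) • μ.restrict P + μ' = μ := by
    simp only [μ']
    rw [add_left_comm, ← add_smul, add_tsub_cancel_of_le hle, one_smul, add_comm,
      Measure.restrict_add_restrict_compl mP]
  have hmass : μ' Set.univ = ν Qᶜ := by
    have h1 := congrArg (fun m => m Set.univ) hsum
    simp only [Measure.add_apply, Measure.smul_apply, Measure.restrict_apply_univ, smul_eq_mul,
      measure_univ] at h1
    rw [ENNReal.div_mul_cancel hP hPt] at h1
    rw [prob_compl_eq_one_sub mQ, ← h1, ENNReal.add_sub_cancel_left hQt]
  have fin2 : IsFiniteMeasure μ' := by simp only [μ']; infer_instance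
  by_cases hQc : ν Qᶜ = 0
  · have hμ'0 : μ' = 0 := Measure.measure_univ_eq_zero.1 (hmass.trans hQc)
    have hν : ν.restrict Q = ν := by
      have := Measure.restrict_add_restrict_compl (μ := ν) mQ
      rwa [Measure.restrict_eq_zero.2 hQc, add_zero] at this
    have fin3 : IsFiniteMeasure ((μ P)⁻¹ • ((μ.restrict P).prod (ν.restrict Q))) :=
      Measure.smul_finite _ (by simpa using hP)
    refine ⟨(μ P)⁻¹ • ((μ.restrict P).prod (ν.restrict Q)), fin3, ?_, ?_, ?_⟩
    · rw [Measure.map_smul, Measure.map_fst_prod, smul_smul, Measure.restrict_apply_univ]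
      rw [hμ'0, add_zero, ENNReal.div_eq_inv_mul] at hsum
      exact hsum
    · rw [Measure.map_smul, Measure.map_snd_prod, smul_smul, Measure.restrict_apply_univ,
        ENNReal.inv_mul_cancel hP hPt, one_smul, hν]
    · rw [Measure.smul_apply]
      have : ((μ.restrict P).prod (ν.restrict Q)) {z | z.2 ∈ Q ∧ z.1 ∉ P} = 0 := by
        refine measure_mono_null (t := Pᶜ ×ˢ Set.univ) ?_ ?_
        · rintro z hz; exact ⟨hz.2, trivial⟩
        · rw [Measure.prod_prod, Measure.restrict_apply mP.compl]; simp
      simp [this]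
  · have hQct := measure_ne_top ν Qᶜ
    have fin3 : IsFiniteMeasure ((μ P)⁻¹ • ((μ.restrict P).prod (ν.restrict Q))) :=
      Measure.smul_finite _ (by simpa using hP)
    have fin4 : IsFiniteMeasure ((ν Qᶜ)⁻¹ • (μ'.prod (ν.restrict Qᶜ))) :=
      Measure.smul_finite _ (by simpa using hQc)
    refine ⟨(μ P)⁻¹ • ((μ.restrict P).prod (ν.restrict Q)) +
      (ν Qᶜ)⁻¹ • (μ'.prod (ν.restrict Qᶜ)), inferInstance, ?_, ?_, ?_⟩
    · rw [Measure.map_add _ _ measurable_fst, Measure.map_smul, Measure.map_fst_prod,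
        Measure.map_smul, Measure.map_fst_prod,
        smul_smul, smul_smul, Measure.restrict_apply_univ, Measure.restrict_apply_univ,
        ENNReal.inv_mul_cancel hQc hQct, one_smul, ← ENNReal.div_eq_inv_mul]
      exact hsum
    · rw [Measure.map_add _ _ measurable_snd, Measure.map_smul, Measure.map_snd_prod,
        Measure.map_smul, Measure.map_snd_prod,
        smul_smul, smul_smul, Measure.restrict_apply_univ, hmass,
        ENNReal.inv_mul_cancel hQc hQct, ENNReal.inv_mul_cancel hP hPt, one_smul, one_smul,
        Measure.restrict_add_restrict_compl mQ]
    · rw [Measure.add_apply, Measure.smul_apply, Measure.smul_apply]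
      have h1 : ((μ.restrict P).prod (ν.restrict Q)) {z | z.2 ∈ Q ∧ z.1 ∉ P} = 0 := by
        refine measure_mono_null (t := Pᶜ ×ˢ Set.univ) ?_ ?_
        · rintro z hz; exact ⟨hz.2, trivial⟩
        · rw [Measure.prod_prod, Measure.restrict_apply mP.compl]; simp
      have h2 : (μ'.prod (ν.restrict Qᶜ)) {z | z.2 ∈ Q ∧ z.1 ∉ P} = 0 := by
        refine measure_mono_null (t := Set.univ ×ˢ Q) ?_ ?_
        · rintro z hz; exact ⟨trivial, hz.1⟩
        · rw [Measure.prod_prod, Measure.restrict_apply mQ]; simp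
      simp [h1, h2]

lemma coupL3 (q : ℝ≥0∞) (hq : q ≤ 1) (S F : Finset E) (hS : S.Nonempty) (hFS : F ⊆ S)
    (h : unifF S (F : Set E) ≤ (Measure.pi fun _ : E => bern q) {x | ∃ e ∈ F, x e = true}) :
    ∃ π : Measure ((E → Bool) × E), IsFiniteMeasure π ∧
      π.map Prod.fst = (Measure.pi fun _ : E => bern q) ∧
      π.map Prod.snd = unifF S ∧
      π {z | z.2 ∈ F ∧ ¬ z.1 z.2 = true} = 0 := by
  have hp := unifF_prob S hS
  have hb := bern_prob q hq
  obtain ⟨π0, hπ0, h1, h2, h3⟩ := coupQP (Measure.pi fun _ : E => bern q) (unifF S)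
    {x | ∃ e ∈ F, x e = true} (F : Set E) h
  have hc : ∀ z : (E → Bool) × E, ∃ σ : Equiv.Perm F, z.2 ∈ F → (∃ e ∈ F, z.1 e = true) →
      z.1 (Equiv.Perm.ofSubtype σ z.2) = true := by
    intro z
    by_cases hz : z.2 ∈ F
    · by_cases hz' : ∃ e ∈ F, z.1 e = true
      · obtain ⟨e, he, hxe⟩ := hz'
        refine ⟨Equiv.swap ⟨z.2, hz⟩ ⟨e, he⟩, fun _ _ => ?_⟩
        rw [Equiv.Perm.ofSubtype_apply_of_mem _ hz, Equiv.swap_apply_left]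
        exact hxe
      · exact ⟨1, fun _ h => absurd h hz'⟩
    · exact ⟨1, fun h => absurd h hz⟩
  choose τ hτ using hc
  obtain ⟨π, hπ, k1, k2, k3⟩ := averaging F (Measure.pi fun _ : E => bern q) (unifF S)
    (fun σ => bernpi_inv q hq _) (fun σ e => Equiv.Perm.ofSubtype σ e)
    (fun σ => unifF_inv S _ (ofSubtype_mem hFS σ)) π0 h1 h2 τ
    {z | z.2 ∈ F ∧ ¬ z.1 z.2 = true} (by
      intro σ x y h
      simp only [Set.mem_setOf_eq, ofSubtype_mem subset_rfl] at h ⊢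
      simpa using h)
  refine ⟨π, hπ, k1, k2, le_antisymm (k3.trans ?_) bot_le⟩
  rw [← nonpos_iff_eq_zero] at h3
  refine (measure_mono ?_).trans h3
  rintro z ⟨hz1, hz2⟩
  exact ⟨hz1, fun hP => hz2 (hτ z hz1 hP)⟩

end Part2

section Part3
variable {E : Type*} [Fintype E] [MeasurableSpace E] [DiscreteMeasurableSpace E]

lemma mix_unif (S F : Finset E) (hFS : F ⊆ S) (hne : (S \ F).Nonempty) :
    ((unifF (S \ F)).prod (unifF S)).map (fun p : E × E => if p.2 ∈ F then p.2 else p.1)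
      = unifF S := by
  have hS : S.Nonempty := hne.mono Finset.sdiff_subset
  have hp := unifF_prob S hS
  have hp' := unifF_prob (S \ F) hne
  apply Measure.ext_of_singleton
  intro t
  rw [Measure.map_apply .of_discrete .of_discrete]
  have : (fun p : E × E => if p.2 ∈ F then p.2 else p.1) ⁻¹' {t} =
      (Set.univ ×ˢ (((F.filter (· = t) : Finset E)) : Set E)) ∪
        ({t} ×ˢ ((Finset.univ \ F : Finset E) : Set E)) := by
    ext p
    by_cases h : p.2 ∈ F <;> simp [h]
  rw [this, measure_union _ .of_discrete, Measure.prod_prod, Measure.prod_prod, unifF_apply,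
    unifF_apply, unifF_singleton, unifF_singleton]
  · have e1 : (Finset.univ \ F) ∩ S = S \ F := by ext; simp [and_comm]
    rw [e1]
    have hc0 : ((S \ F).card : ℝ≥0∞) ≠ 0 := by simpa using hne.ne_empty
    by_cases htF : t ∈ F
    · have e2 : F.filter (· = t) ∩ S = {t} := by
        ext a; simp; constructor
        · rintro ⟨⟨_, h⟩, _⟩; exact h
        · rintro rfl; exact ⟨⟨htF, rfl⟩, hFS htF⟩
      rw [e2]; simp [htF, hFS htF]
    · have e2 : F.filter (· = t) ∩ S = ∅ := by
        ext a; simp; rintro h rfl; exact absurd h htF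
      rw [e2]
      by_cases htS : t ∈ S
      · simp only [Finset.mem_sdiff, htS, htF, not_false_eq_true, and_self, if_true,
          Finset.card_empty, Nat.cast_zero, mul_zero, zero_add]
        rw [mul_left_comm, ENNReal.inv_mul_cancel hc0 (by simp), mul_one]
      · simp [htS]
  · rw [Set.disjoint_left]
    rintro ⟨a, b⟩ h1 h2
    simp at h1 h2
    exact h2.2 h1.1

lemma coupL2 {J : Type*} [Fintype J] (p1 q3 : ℝ≥0∞) (hp1 : p1 ≤ 1) (hq3 : q3 ≤ 1)
    (S F : Finset E) (hFS : F ⊆ S) (hne : (S \ F).Nonempty)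
    (h : unifF S (F : Set E) ≤ (Measure.pi fun _ : E => bern q3) {x | ∃ e ∈ F, x e = true}) :
    ∃ π : Measure (((E → Bool) × (J → E → Bool)) × (J → E)), IsFiniteMeasure π ∧
      π.map Prod.fst = (Measure.pi fun _ : E => bern p1).prod
        (Measure.pi fun _ : J => Measure.pi fun _ : E => bern q3) ∧
      π.map Prod.snd = Measure.pi (fun _ : J => unifF S) ∧
      π {z | ¬ ∀ j, (z.2 j ∈ S \ F ∧ z.1.1 (z.2 j) = true) ∨ z.1.2 j (z.2 j) = true} ≤
        (Measure.pi fun _ : E => bern p1)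
          {x | ((S \ F).filter (fun e => x e = true)).card < Fintype.card J} := by
  have hS : S.Nonempty := hne.mono Finset.sdiff_subset
  have hp := unifF_prob S hS
  have hp' := unifF_prob (S \ F) hne
  have hb1 := bern_prob p1 hp1
  have hb3 := bern_prob q3 hq3
  obtain ⟨πa, hπa, a1, a2, a3⟩ := coupL1 (J := J) (S \ F) hne (Measure.pi fun _ : E => bern p1)
    (fun σ => bernpi_inv p1 hp1 _)
  rw [measure_univ, one_smul] at a2
  obtain ⟨πb, hπb, b1, b2, b3⟩ := coupL3 q3 hq3 S F hS hFS h
  have hπb' : IsProbabilityMeasure πb := by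
    constructor
    have := congrArg (fun m => m Set.univ) b2
    simpa [Measure.map_apply measurable_snd MeasurableSet.univ] using this
  let P := πa.prod (Measure.pi fun _ : J => πb)
  let Z : ((E → Bool) × (J → E)) × (J → (E → Bool) × E) →
      ((E → Bool) × (J → E → Bool)) × (J → E) := fun p =>
    ((p.1.1, fun j => (p.2 j).1), fun j => if (p.2 j).2 ∈ F then (p.2 j).2 else p.1.2 j)
  have c1 : (Measure.pi fun _ : J => πb).map (fun w j => (w j).1) =
      Measure.pi fun _ : J => Measure.pi fun _ : E => bern q3 := by
    rw [Measure.pi_map_pi (f := fun _ : J => Prod.fst) (fun _ => measurable_fst.aemeasurable), b1]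
  have c2 : (Measure.pi fun _ : J => πb).map (fun w j => (w j).2) =
      Measure.pi fun _ : J => unifF S := by
    rw [Measure.pi_map_pi (f := fun _ : J => Prod.snd) (fun _ => measurable_snd.aemeasurable), b2]
  refine ⟨P.map Z, inferInstance, ?_, ?_, ?_⟩
  · rw [Measure.map_map .of_discrete .of_discrete]
    have s1 : MeasurePreserving (Prod.fst : (E → Bool) × (J → E) → _) πa _ :=
      ⟨measurable_fst, a1⟩
    have s2 : MeasurePreserving (fun (w : J → (E → Bool) × E) j => (w j).1)
      (Measure.pi fun _ : J => πb) _ := ⟨.of_discrete, c1⟩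
    exact (s1.prod s2).map_eq
  · rw [Measure.map_map .of_discrete .of_discrete]
    have s1 : MeasurePreserving (Prod.snd : (E → Bool) × (J → E) → _) πa _ :=
      ⟨measurable_snd, a2⟩
    have s2 : MeasurePreserving (fun (w : J → (E → Bool) × E) j => (w j).2)
      (Measure.pi fun _ : J => πb) _ := ⟨.of_discrete, c2⟩
    have s3 := (measurePreserving_arrowProdEquivProdArrow E E J (fun _ => unifF (S \ F))
      (fun _ => unifF S)).symm
    have s4 : MeasurePreserving (fun (w : J → E × E) j => if (w j).2 ∈ F then (w j).2 else (w j).1)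
       (Measure.pi fun _ : J => (unifF (S \ F)).prod (unifF S))
       (Measure.pi fun _ : J => unifF S) := by
      refine ⟨.of_discrete, ?_⟩
      rw [Measure.pi_map_pi (f := fun (_ : J) (p : E × E) => if p.2 ∈ F then p.2 else p.1)
        (fun _ => Measurable.of_discrete.aemeasurable)]
      simp_rw [mix_unif S F hFS hne]
    exact (s4.comp (s3.comp (s1.prod s2))).map_eq
  · rw [Measure.map_apply .of_discrete .of_discrete]
    have n1 : P (Set.univ ×ˢ {w | ¬ ∀ j, ¬ ((w j).2 ∈ F ∧ ¬ (w j).1 (w j).2 = true)}) = 0 := by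
      rw [Measure.prod_prod]
      convert mul_zero _
      have : {w : J → (E → Bool) × E | ¬ ∀ j, ¬ ((w j).2 ∈ F ∧ ¬ (w j).1 (w j).2 = true)}
        = ⋃ j, {w | (w j).2 ∈ F ∧ ¬ (w j).1 (w j).2 = true} := by
          ext w; simp
      rw [this, measure_iUnion_null_iff]
      intro j
      exact Measure.pi_eval_preimage_null (fun _ : J => πb) b3
    have n2 : P ({z | ¬ ∀ j, z.2 j ∈ S \ F} ×ˢ Set.univ) = 0 := by
      rw [Measure.prod_prod]
      convert zero_mul _
      have := pi_unif_null (J := J) (S \ F)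
      rwa [← a2, Measure.map_apply .of_discrete .of_discrete] at this
    calc P (Z ⁻¹' _) ≤ P (({z | ¬ ∀ j, z.1 (z.2 j) = true} ×ˢ Set.univ) ∪
          ((Set.univ ×ˢ {w | ¬ ∀ j, ¬ ((w j).2 ∈ F ∧ ¬ (w j).1 (w j).2 = true)}) ∪
          ({z | ¬ ∀ j, z.2 j ∈ S \ F} ×ˢ Set.univ))) := by
          apply measure_mono
          rintro ⟨⟨x, g⟩, w⟩ hz
          by_contra hcon
          simp only [Set.mem_union, Set.mem_prod, Set.mem_setOf_eq, Set.mem_univ, and_true,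
            true_and, not_or, not_not] at hcon
          obtain ⟨k1, k2, k3⟩ := hcon
          apply hz
          intro j
          by_cases hj : (w j).2 ∈ F
          · right
            simp only [Z, hj, if_true]
            have := k2 j
            tauto
          · left
            simp only [Z, hj, if_false]
            exact ⟨k3 j, k1 j⟩
      _ ≤ _ := measure_union_le _ _
      _ ≤ P ({z | ¬ ∀ j, z.1 (z.2 j) = true} ×ˢ Set.univ) + 0 := by
          gcongr
          refine (measure_union_le _ _).trans ?_
          rw [n1, n2]; simp
      _ ≤ _ := by
          rw [add_zero, Measure.prod_prod]
          simpa using a3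

end Part3

section Part4
variable {E : Type*} [Fintype E] [MeasurableSpace E] [DiscreteMeasurableSpace E]

lemma card_filter_perm (S : Finset E) (σ : Equiv.Perm S) (x : E → Bool) :
    (S.filter (fun e => (x ∘ Equiv.Perm.ofSubtype σ) e = true)).card
      = (S.filter (fun e => x e = true)).card := by
  apply Finset.card_bij (fun e _ => Equiv.Perm.ofSubtype σ e)
  · intro e he
    simp only [Finset.mem_filter, Function.comp] at he ⊢
    exact ⟨(ofSubtype_mem subset_rfl σ e).2 he.1, he.2⟩
  · intro a _ b _ h; exact (Equiv.Perm.ofSubtype σ).injective h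
  · intro b hb
    simp only [Finset.mem_filter] at hb
    refine ⟨(Equiv.Perm.ofSubtype σ).symm b, ?_, by simp⟩
    simp only [Finset.mem_filter, Function.comp, Equiv.apply_symm_apply]
    refine ⟨?_, hb.2⟩
    rw [← ofSubtype_mem subset_rfl σ, Equiv.apply_symm_apply]; exact hb.1

/-- the failure event at a vertex -/
def badV {J : Type*} (A : Finset E) :
    Set (((E → Bool) × ((E → Bool) × (J → E → Bool))) × (J → E)) :=
  {z | ¬ ∀ j, (z.2 j ∈ A ∧ z.1.1 (z.2 j) = true) ∨ z.1.2.1 (z.2 j) = true ∨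
    z.1.2.2 j (z.2 j) = true}

lemma coupCin {J : Type*} [Fintype J] (p1 q3 : ℝ≥0∞) (hp1 : p1 ≤ 1) (hq3 : q3 ≤ 1)
    (κ : Measure (E → Bool)) [IsFiniteMeasure κ]
    (S F : Finset E) (hFS : F ⊆ S) (hne : (S \ F).Nonempty)
    (h : unifF S (F : Set E) ≤ (Measure.pi fun _ : E => bern q3) {x | ∃ e ∈ F, x e = true}) :
    ∃ π : Measure (((E → Bool) × ((E → Bool) × (J → E → Bool))) × (J → E)), IsFiniteMeasure π ∧
      π.map Prod.fst = (Measure.pi fun _ : E => bern p1).prod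
        (κ.prod (Measure.pi fun _ : J => Measure.pi fun _ : E => bern q3)) ∧
      π.map Prod.snd = κ Set.univ • Measure.pi (fun _ : J => unifF S) ∧
      π (badV (S \ F)) ≤
        (Measure.pi fun _ : E => bern p1)
          {x | ((S \ F).filter (fun e => x e = true)).card < Fintype.card J} * κ Set.univ := by
  have hb1 := bern_prob p1 hp1
  have hb3 := bern_prob q3 hq3
  obtain ⟨π0, hπ0, a1, a2, a3⟩ := coupL2 (J := J) p1 q3 hp1 hq3 S F hFS hne h
  let Z : (((E → Bool) × (J → E → Bool)) × (J → E)) × (E → Bool) →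
    (((E → Bool) × ((E → Bool) × (J → E → Bool))) × (J → E)) :=
    fun p => ((p.1.1.1, (p.2, p.1.1.2)), p.1.2)
  refine ⟨(π0.prod κ).map Z, inferInstance, ?_, ?_, ?_⟩
  · rw [Measure.map_map .of_discrete .of_discrete]
    have s1 : MeasurePreserving (Prod.fst) π0 _ := ⟨measurable_fst, a1⟩
    have s2 := s1.prod (MeasurePreserving.id κ)
    have s3 : MeasurePreserving (fun p : ((E → Bool) × (J → E → Bool)) × (E → Bool) =>
        (p.1.1, (p.2, p.1.2)))
        (((Measure.pi fun _ : E => bern p1).prod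
        (Measure.pi fun _ : J => Measure.pi fun _ : E => bern q3)).prod κ)
        ((Measure.pi fun _ : E => bern p1).prod
        (κ.prod (Measure.pi fun _ : J => Measure.pi fun _ : E => bern q3))) := by
      refine ⟨.of_discrete, ?_⟩
      apply Measure.ext_of_singleton
      rintro ⟨a, b, c⟩
      rw [Measure.map_apply .of_discrete .of_discrete]
      have : (fun p : ((E → Bool) × (J → E → Bool)) × (E → Bool) =>
        (p.1.1, (p.2, p.1.2))) ⁻¹' {(a, b, c)} = ({a} ×ˢ {c}) ×ˢ {b} := by
        ext ⟨⟨u, v⟩, w⟩; simp; tauto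
      rw [this, ← Set.singleton_prod_singleton, ← Set.singleton_prod_singleton]
      simp only [Measure.prod_prod]
      ring
    exact (s3.comp s2).map_eq
  · rw [Measure.map_map .of_discrete .of_discrete]
    have : (Prod.snd ∘ Z) = Prod.snd ∘ Prod.fst := rfl
    rw [this, ← Measure.map_map .of_discrete .of_discrete, Measure.map_fst_prod, Measure.map_smul,
      a2]
  · rw [Measure.map_apply .of_discrete .of_discrete]
    calc (π0.prod κ) (Z ⁻¹' _) ≤ (π0.prod κ) ({z | ¬ ∀ j, (z.2 j ∈ S \ F ∧ z.1.1 (z.2 j) = true) ∨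
            z.1.2 j (z.2 j) = true} ×ˢ Set.univ) := by
          apply measure_mono
          rintro z hz
          refine ⟨fun hh => hz fun j => ?_, trivial⟩
          rcases hh j with h | h
          · exact Or.inl h
          · exact Or.inr (Or.inr h)
      _ ≤ _ := by rw [Measure.prod_prod]; gcongr

lemma coupCout {J : Type*} [Fintype J] (p1 q3 : ℝ≥0∞) (hp1 : p1 ≤ 1) (hq3 : q3 ≤ 1)
    (κ : Measure (E → Bool)) [IsFiniteMeasure κ]
    (S A : Finset E) (hS : S.Nonempty)
    (hκ : ∀ σ : Equiv.Perm S,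
      MeasurePreserving (fun x : E → Bool => x ∘ (Equiv.Perm.ofSubtype σ)) κ κ)
    (h0 : κ {x | (S.filter (fun e => x e = true)).card < Fintype.card J} = 0) :
    ∃ π : Measure (((E → Bool) × ((E → Bool) × (J → E → Bool))) × (J → E)), IsFiniteMeasure π ∧
      π.map Prod.fst = (Measure.pi fun _ : E => bern p1).prod
        (κ.prod (Measure.pi fun _ : J => Measure.pi fun _ : E => bern q3)) ∧
      π.map Prod.snd = κ Set.univ • Measure.pi (fun _ : J => unifF S) ∧
      π (badV A) = 0 := by
  have hb1 := bern_prob p1 hp1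
  have hb3 := bern_prob q3 hq3
  obtain ⟨π0, hπ0, a1, a2, a3⟩ := coupL1 (J := J) S hS κ hκ
  rw [h0] at a3
  let M1 := (Measure.pi fun _ : E => bern p1)
  let M3 := (Measure.pi fun _ : J => Measure.pi fun _ : E => bern q3)
  let Z : ((E → Bool) × (J → E)) × ((E → Bool) × (J → E → Bool)) →
    (((E → Bool) × ((E → Bool) × (J → E → Bool))) × (J → E)) :=
    fun p => ((p.2.1, (p.1.1, p.2.2)), p.1.2)
  refine ⟨(π0.prod (M1.prod M3)).map Z, inferInstance, ?_, ?_, ?_⟩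
  · rw [Measure.map_map .of_discrete .of_discrete]
    have s1 : MeasurePreserving (Prod.fst) π0 _ := ⟨measurable_fst, a1⟩
    have s2 := s1.prod (MeasurePreserving.id (M1.prod M3))
    have s3 : MeasurePreserving (fun p : (E → Bool) × ((E → Bool) × (J → E → Bool)) =>
        (p.2.1, (p.1, p.2.2)))
        (κ.prod (M1.prod M3))
        (M1.prod (κ.prod M3)) := by
      refine ⟨.of_discrete, ?_⟩
      apply Measure.ext_of_singleton
      rintro ⟨a, b, c⟩
      rw [Measure.map_apply .of_discrete .of_discrete]
      have : (fun p : (E → Bool) × ((E → Bool) × (J → E → Bool)) =>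
        (p.2.1, (p.1, p.2.2))) ⁻¹' {(a, b, c)} = {b} ×ˢ ({a} ×ˢ {c}) := by
        ext ⟨u, ⟨v, w⟩⟩; simp; tauto
      rw [this, ← Set.singleton_prod_singleton, ← Set.singleton_prod_singleton]
      simp only [Measure.prod_prod]
      ring
    exact (s3.comp s2).map_eq
  · rw [Measure.map_map .of_discrete .of_discrete]
    have : (Prod.snd ∘ Z) = Prod.snd ∘ Prod.fst := rfl
    rw [this, ← Measure.map_map .of_discrete .of_discrete, Measure.map_fst_prod, Measure.map_smul,
      a2]
    simp [M1, M3]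
  · rw [Measure.map_apply .of_discrete .of_discrete]
    refine measure_mono_null (t := {z | ¬ ∀ j, z.1 (z.2 j) = true} ×ˢ Set.univ) ?_ ?_
    · rintro z hz
      exact ⟨fun hh => hz fun j => Or.inr (Or.inl (hh j)), trivial⟩
    · rw [Measure.prod_prod, le_antisymm a3 bot_le, zero_mul]

/-- the event that a vertex has few edges of its own -/
def fewV (S : Finset E) (m : ℕ) : Set (E → Bool) :=
  {x | (S.filter (fun e => x e = true)).card < m}

lemma coupC {J : Type*} [Fintype J] (p1 q2 q3 : ℝ≥0∞) (hp1 : p1 ≤ 1) (hq2 : q2 ≤ 1) (hq3 : q3 ≤ 1)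
    (S A : Finset E) (hS : S.Nonempty) (hAS : A ⊆ S) (δ : ℝ≥0∞) (inb small : Prop)
    (hne : small → inb → A.Nonempty)
    (hδ : small → inb → (Measure.pi fun _ : E => bern p1) (fewV A (Fintype.card J)) ≤ δ)
    (h : small → inb → unifF S ((S \ A : Finset E) : Set E) ≤
      (Measure.pi fun _ : E => bern q3) {x | ∃ e ∈ S \ A, x e = true}) :
    ∃ π : Measure (((E → Bool) × ((E → Bool) × (J → E → Bool))) × (J → E)), IsFiniteMeasure π ∧
      π.map Prod.fst = (Measure.pi fun _ : E => bern p1).prod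
        (((Measure.pi fun _ : E => bern q2).restrict {x | x ∈ fewV S (Fintype.card J) ↔ inb}).prod
          (Measure.pi fun _ : J => Measure.pi fun _ : E => bern q3)) ∧
      π.map Prod.snd = (Measure.pi fun _ : E => bern q2) {x | x ∈ fewV S (Fintype.card J) ↔ inb} •
        Measure.pi (fun _ : J => unifF S) ∧
      (small → π (badV A) ≤
        δ * (Measure.pi fun _ : E => bern q2) {x | x ∈ fewV S (Fintype.card J) ↔ inb}) := by
  have hb1 := bern_prob p1 hp1
  have hb2 := bern_prob q2 hq2
  have hb3 := bern_prob q3 hq3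
  have hpS := unifF_prob S hS
  by_cases hs : small
  · by_cases hb : inb
    · have e : S \ (S \ A) = A := by rw [Finset.sdiff_sdiff_eq_self hAS]
      obtain ⟨π, k0, k1, k2, k3⟩ := coupCin (J := J) p1 q3 hp1 hq3
        ((Measure.pi fun _ : E => bern q2).restrict {x | x ∈ fewV S (Fintype.card J) ↔ inb})
        S (S \ A) Finset.sdiff_subset (by rw [e]; exact hne hs hb) (h hs hb)
      rw [e, Measure.restrict_apply_univ] at k3
      rw [Measure.restrict_apply_univ] at k2
      refine ⟨π, k0, k1, k2, fun _ => k3.trans ?_⟩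
      gcongr
      exact hδ hs hb
    · obtain ⟨π, k0, k1, k2, k3⟩ := coupCout (J := J) p1 q3 hp1 hq3
        ((Measure.pi fun _ : E => bern q2).restrict {x | x ∈ fewV S (Fintype.card J) ↔ inb})
        S A hS (by
          intro σ
          have := (bernpi_inv q2 hq2 (Equiv.Perm.ofSubtype σ)).restrict_preimage
            (s := {x | x ∈ fewV S (Fintype.card J) ↔ inb}) .of_discrete
          convert this using 2
          ext x
          simp only [fewV, Set.mem_setOf_eq, Set.mem_preimage, card_filter_perm]) (by
          rw [Measure.restrict_apply .of_discrete]
          convert measure_empty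
          · ext x; simp [hb, fewV]
          · infer_instance)
      rw [Measure.restrict_apply_univ] at k2
      refine ⟨π, k0, k1, k2, fun _ => by rw [k3]; exact bot_le⟩
  · refine ⟨((Measure.pi fun _ : E => bern p1).prod
        (((Measure.pi fun _ : E => bern q2).restrict {x | x ∈ fewV S (Fintype.card J) ↔ inb}).prod
          (Measure.pi fun _ : J => Measure.pi fun _ : E => bern q3))).prod
          (Measure.pi (fun _ : J => unifF S)), inferInstance, ?_, ?_, fun h => absurd h hs⟩
    · rw [Measure.map_fst_prod]; simp
    · rw [Measure.map_snd_prod]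
      simp [← Set.univ_prod_univ]
end Part4

section Part5

lemma sum_restrict_fiber {X ι : Type*} [MeasurableSpace X] [DiscreteMeasurableSpace X]
    [Fintype ι] (μ : Measure X) (B : X → ι) :
    ∑ b, μ.restrict (B ⁻¹' {b}) = μ := by
  ext s hs
  rw [Measure.finset_sum_apply]
  have h : s = ⋃ b ∈ (Finset.univ : Finset ι), s ∩ B ⁻¹' {b} := by ext x; simp
  conv_rhs => rw [h]
  rw [measure_biUnion_finset]
  · exact Finset.sum_congr rfl fun b _ => Measure.restrict_apply hs
  · intro a _ b _ hab
    rw [Function.onFun, Set.disjoint_left]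
    rintro x ⟨_, h1⟩ ⟨_, h2⟩
    exact hab (h1.symm.trans h2)
  · intro b _; exact .of_discrete

lemma map_finset_sum' {X Y ι : Type*} [MeasurableSpace X] [MeasurableSpace Y]
    (s : Finset ι) (μ : ι → Measure X) (f : X → Y) (hf : Measurable f) :
    (∑ b ∈ s, μ b).map f = ∑ b ∈ s, (μ b).map f := by
  ext t ht
  rw [Measure.map_apply hf ht, Measure.finset_sum_apply, Measure.finset_sum_apply]
  exact Finset.sum_congr rfl fun b _ => (Measure.map_apply hf ht).symm

lemma sum_restrict_map {X Y ι : Type*} [MeasurableSpace X] [DiscreteMeasurableSpace X]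
    [MeasurableSpace Y] [Fintype ι] (μ : Measure X) (B : X → ι) (h : ι → X → Y) :
    ∑ b, (μ.restrict (B ⁻¹' {b})).map (h b) = μ.map (fun x => h (B x) x) := by
  conv_rhs => rw [← sum_restrict_fiber μ B]
  rw [map_finset_sum' _ _ _ .of_discrete]
  refine Finset.sum_congr rfl fun b _ => Measure.map_congr ?_
  filter_upwards [ae_restrict_mem (MeasurableSet.of_discrete)] with x hx
  have : B x = b := hx
  rw [this]

lemma bool_measure_ext (μ ν : Measure Bool) [IsProbabilityMeasure μ] [IsProbabilityMeasure ν]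
    (h : μ {false} = ν {false}) : μ = ν := by
  apply Measure.ext_of_singleton
  intro a
  cases a
  · exact h
  · have : ({true} : Set Bool) = {false}ᶜ := by ext a; cases a <;> simp
    rw [this, prob_compl_eq_one_sub .of_discrete, prob_compl_eq_one_sub .of_discrete, h]

variable {V E J : Type*} [Fintype V] [Fintype E] [Fintype J]

lemma select_law (q : ℝ≥0∞) (hq : q ≤ 1) (o : E → V) :
    (Measure.pi fun _ : V => Measure.pi fun _ : E => bern q).map (fun w e => w (o e) e) =
      Measure.pi fun _ : E => bern q := by
  have hb := bern_prob q hq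
  have h1 : MeasurePreserving (fun (w : V → E → Bool) (e : E) (v : V) => w v e)
      (Measure.pi fun _ : V => Measure.pi fun _ : E => bern q)
      (Measure.pi fun _ : E => Measure.pi fun _ : V => bern q) := by
    refine ⟨.of_discrete, ?_⟩
    apply Measure.ext_of_singleton
    intro a
    rw [Measure.map_apply .of_discrete .of_discrete]
    have : (fun (w : V → E → Bool) (e : E) (v : V) => w v e) ⁻¹' {a} = {fun v e => a e v} := by
      ext w
      simp only [Set.mem_preimage, Set.mem_singleton_iff, funext_iff]
      exact ⟨fun h a b => h b a, fun h a b => h b a⟩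
    rw [this]
    simp only [Measure.pi_singleton]
    exact Finset.prod_comm
  have h2 : (Measure.pi fun _ : E => Measure.pi fun _ : V => bern q).map (fun u e => u e (o e)) =
      Measure.pi fun _ : E => bern q := by
    have e1 : ∀ e : E, (Measure.pi fun _ : V => bern q).map (fun u : V → Bool => u (o e)) = bern q :=
      fun e => (measurePreserving_eval (fun _ : V => bern q) (o e)).map_eq
    rw [Measure.pi_map_pi (f := fun (e : E) (u : V → Bool) => u (o e))
      (hμ := fun e => by rw [e1 e]; infer_instance)
      (fun _ => Measurable.of_discrete.aemeasurable)]
    simp_rw [e1]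
  have h3 : (Measure.pi fun _ : V => Measure.pi fun _ : E => bern q).map (fun w e => w (o e) e) =
      ((Measure.pi fun _ : V => Measure.pi fun _ : E => bern q).map
        (fun (w : V → E → Bool) (e : E) (v : V) => w v e)).map (fun u e => u e (o e)) := by
    rw [Measure.map_map .of_discrete .of_discrete]; rfl
  rw [h3, h1.map_eq, h2]

/-- the hypergraph built from the resources -/
noncomputable def hyp (star : V → Finset E) (owner : Finset V → E → V) (b : Finset V)
    (w : V → (E → Bool) × ((E → Bool) × (J → E → Bool))) (e : E) : Bool :=
  decide ((w (owner b e)).1 e = true ∨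
    ∃ v, e ∈ star v ∧ ((w v).2.1 e = true ∨ ∃ j, (w v).2.2 j e = true))

lemma hyp_law (star : V → Finset E) (owner : Finset V → E → V) (r : ℕ)
    (hinc : ∀ e, (Finset.univ.filter (fun v => e ∈ star v)).card = r)
    (p p1 q2 q3 : ℝ≥0∞) (hp : p ≤ 1) (hp1 : p1 ≤ 1) (hq2 : q2 ≤ 1) (hq3 : q3 ≤ 1)
    (hpp : (1 - p1) * ((1 - q2) * (1 - q3) ^ Fintype.card J) ^ r = 1 - p)
    (B : (V → (E → Bool) × (J → E → Bool)) → Finset V) :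
    (Measure.pi fun _ : V => (Measure.pi fun _ : E => bern p1).prod
        ((Measure.pi fun _ : E => bern q2).prod
          (Measure.pi fun _ : J => Measure.pi fun _ : E => bern q3))).map
      (fun w => hyp star owner (B (fun v => (w v).2)) w) = Measure.pi fun _ : E => bern p := by
  have hb := bern_prob p hp
  have hb1 := bern_prob p1 hp1
  have hb2 := bern_prob q2 hq2
  have hb3 := bern_prob q3 hq3
  let M1 := Measure.pi fun _ : E => bern p1
  let M23 := (Measure.pi fun _ : E => bern q2).prod
          (Measure.pi fun _ : J => Measure.pi fun _ : E => bern q3)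
  have s1 := measurePreserving_arrowProdEquivProdArrow (E → Bool) ((E → Bool) × (J → E → Bool)) V
    (fun _ => M1) (fun _ => M23)
  have s2 : MeasurePreserving Prod.swap ((Measure.pi fun _ : V => M1).prod
    (Measure.pi fun _ : V => M23)) _ := Measure.measurePreserving_swap
  -- transpose of second component
  let ρ : Measure (Bool × (J → Bool)) := (bern q2).prod (Measure.pi fun _ : J => bern q3)
  have t2 : MeasurePreserving (fun (w : V → (E → Bool) × (J → E → Bool)) (e : E) (v : V) =>
      ((w v).1 e, fun j => (w v).2 j e)) (Measure.pi fun _ : V => M23)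
      (Measure.pi fun _ : E => Measure.pi fun _ : V => ρ) := by
    refine ⟨.of_discrete, ?_⟩
    apply Measure.ext_of_singleton
    intro a
    rw [Measure.map_apply .of_discrete .of_discrete]
    have : (fun (w : V → (E → Bool) × (J → E → Bool)) (e : E) (v : V) =>
      ((w v).1 e, fun j => (w v).2 j e)) ⁻¹' {a} =
        {fun v => (fun e => (a e v).1, fun j e => (a e v).2 j)} := by
      ext w
      simp only [Set.mem_preimage, Set.mem_singleton_iff]
      constructor
      · rintro rfl; rfl
      · rintro rfl; rfl
    rw [this]
    have e1 : ∀ (x : E → Bool) (y : J → E → Bool), M23 {(x, y)} =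
        ∏ e, (bern q2 {x e} * ∏ j, bern q3 {y j e}) := by
      intro x y
      rw [← Set.singleton_prod_singleton, Measure.prod_prod, Measure.pi_singleton,
        Measure.pi_singleton, Finset.prod_mul_distrib]
      simp only [Measure.pi_singleton]
      rw [Finset.prod_comm]
    have e2 : ∀ (y : Bool × (J → Bool)), ρ {y} = bern q2 {y.1} * ∏ j, bern q3 {y.2 j} := by
      rintro ⟨x, y⟩
      rw [← Set.singleton_prod_singleton, Measure.prod_prod, Measure.pi_singleton]
    simp only [Measure.pi_singleton, e1, e2]
    exact Finset.prod_comm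
  have s3 : MeasurePreserving (fun z : (V → (E → Bool) × (J → E → Bool)) × (V → E → Bool) =>
      ((fun (e : E) (v : V) => ((z.1 v).1 e, fun j => (z.1 v).2 j e)),
        fun e => z.2 (owner (B z.1) e) e)) ((Measure.pi fun _ : V => M23).prod
        (Measure.pi fun _ : V => M1)) ((Measure.pi fun _ : E => Measure.pi fun _ : V => ρ).prod M1) :=
    t2.skew_product (μc := Measure.pi fun _ : V => M1) (μd := M1)
      (g := fun (w2 : V → (E → Bool) × (J → E → Bool)) (w1 : V → E → Bool) (e : E) => w1 (owner (B w2) e) e) .of_discrete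
      (ae_of_all _ fun z => select_law p1 hp1 _)
  have s4 := (measurePreserving_arrowProdEquivProdArrow (V → Bool × (J → Bool)) Bool E
    (fun _ => Measure.pi fun _ : V => ρ) (fun _ => bern p1)).symm
  let G : E → (V → Bool × (J → Bool)) × Bool → Bool := fun e z =>
    decide (z.2 = true ∨ ∃ v, e ∈ star v ∧ ((z.1 v).1 = true ∨ ∃ j, (z.1 v).2 j = true))
  have hG : ∀ e, ((Measure.pi fun _ : V => ρ).prod (bern p1)).map (G e) = bern p := by
    intro e
    have : IsProbabilityMeasure (((Measure.pi fun _ : V => ρ).prod (bern p1)).map (G e)) :=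
      Measure.isProbabilityMeasure_map Measurable.of_discrete.aemeasurable
    apply bool_measure_ext
    rw [bern_false, Measure.map_apply .of_discrete .of_discrete]
    have : G e ⁻¹' {false} = (Set.univ.pi fun v => if e ∈ star v then
        ({false} ×ˢ {fun _ => false}) else Set.univ) ×ˢ {false} := by
      ext ⟨x, y⟩
      simp only [G, Set.mem_preimage, Set.mem_singleton_iff, decide_eq_false_iff_not, not_or,
        not_exists, not_and, Set.mem_prod, Set.mem_pi, Set.mem_univ, forall_true_left,
        Bool.not_eq_true]
      rw [and_comm]
      apply and_congr_left
      intro _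
      apply forall_congr'
      intro v
      by_cases hv : e ∈ star v
      · simp only [hv, forall_true_left, if_true, Set.mem_prod, Set.mem_singleton_iff, funext_iff]
      · simp [hv]
    rw [this, Measure.prod_prod, bern_false, Measure.pi_pi, mul_comm, ← hpp]
    congr 1
    have e3 : ∀ v, ρ (if e ∈ star v then ({false} ×ˢ {fun _ => false}) else Set.univ) =
        if e ∈ star v then ((1 - q2) * (1 - q3) ^ Fintype.card J) else 1 := by
      intro v
      split_ifs
      · rw [Measure.prod_prod, bern_false, Measure.pi_singleton]
        simp [bern_false]
      · simp
    simp only [e3]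
    rw [Finset.prod_ite]
    simp [hinc]
  have s5 : MeasurePreserving (fun (z : E → (V → Bool × (J → Bool)) × Bool) e => G e (z e))
      (Measure.pi fun _ : E => (Measure.pi fun _ : V => ρ).prod (bern p1))
      (Measure.pi fun _ : E => bern p) := by
    refine ⟨.of_discrete, ?_⟩
    rw [Measure.pi_map_pi (hμ := fun e => by rw [hG e]; infer_instance)
      (fun _ => Measurable.of_discrete.aemeasurable)]
    simp_rw [hG]
  exact (s5.comp (s4.comp (s3.comp (s2.comp s1)))).map_eq

end Part5

section Part6

variable {V E J : Type*} [Fintype V] [Fintype E] [Fintype J]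

lemma pi_smul_const {ι X : Type*} [Fintype ι] [Fintype X] [MeasurableSpace X] [DiscreteMeasurableSpace X]
    (c : ι → ℝ≥0∞) (hc : ∀ i, c i ≠ ⊤) (ν : ι → Measure X) [∀ i, IsFiniteMeasure (ν i)] :
    Measure.pi (fun i => c i • ν i) = (∏ i, c i) • Measure.pi ν := by
  have : ∀ i, IsFiniteMeasure (c i • ν i) := fun i => Measure.smul_finite _ (hc i)
  apply Measure.ext_of_singleton
  intro a
  simp [Measure.pi_singleton, Finset.prod_mul_distrib]

set_option synthInstance.maxHeartbeats 200000 in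
set_option maxHeartbeats 1000000 in
lemma absThm [MeasurableSpace E] [DiscreteMeasurableSpace E]
    (star : V → Finset E) (hstar : ∀ v, (star v).Nonempty)
    (owner : Finset V → E → V) (r : ℕ)
    (hinc : ∀ e, (Finset.univ.filter (fun v => e ∈ star v)).card = r)
    (p p1 q2 q3 : ℝ≥0∞) (hp : p ≤ 1) (hp1 : p1 ≤ 1) (hq2 : q2 ≤ 1) (hq3 : q3 ≤ 1)
    (hpp : (1 - p1) * ((1 - q2) * (1 - q3) ^ Fintype.card J) ^ r = 1 - p)
    (L β δ : ℝ≥0∞) (hL : L ≠ 0) (hL' : L ≠ ⊤)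
    (hβ : ∀ v, (Measure.pi fun _ : E => bern q2) (fewV (star v) (Fintype.card J)) ≤ β)
    (hne : ∀ (b : Finset V), (b.card : ℝ≥0∞) ≤ L → ∀ v ∈ b,
      ((star v).filter (fun e => owner b e = v)).Nonempty)
    (hδ : ∀ (b : Finset V), (b.card : ℝ≥0∞) ≤ L → ∀ v ∈ b,
      (Measure.pi fun _ : E => bern p1)
        (fewV ((star v).filter (fun e => owner b e = v)) (Fintype.card J)) ≤ δ)
    (h3 : ∀ (b : Finset V), (b.card : ℝ≥0∞) ≤ L → ∀ v ∈ b,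
      unifF (star v) ((star v \ ((star v).filter (fun e => owner b e = v)) : Finset E) : Set E) ≤
      (Measure.pi fun _ : E => bern q3)
        {x | ∃ e ∈ star v \ ((star v).filter (fun e => owner b e = v)), x e = true}) :
    ∃ π : Measure ((E → Bool) × (V → J → E)),
      π.map Prod.fst = Measure.pi (fun _ : E => bern p) ∧
      π.map Prod.snd = Measure.pi (fun v : V => Measure.pi fun _ : J => unifF (star v)) ∧
      π {z | ¬ ∀ v j, z.1 (z.2 v j) = true} ≤
        Fintype.card V * β / L + Fintype.card V * δ := by
  have hd0 : DiscreteMeasurableSpace ((E → Bool) × ((E → Bool) × (J → E → Bool))) := inferInstance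
  have hd1 : DiscreteMeasurableSpace (((E → Bool) × ((E → Bool) × (J → E → Bool))) × (J → E)) :=
    inferInstance
  have hf1 : Finite (((E → Bool) × ((E → Bool) × (J → E → Bool))) × (J → E)) := inferInstance
  have hc1 : Countable (((E → Bool) × ((E → Bool) × (J → E → Bool))) × (J → E)) := inferInstance
  have hd2 : DiscreteMeasurableSpace (V → ((E → Bool) × ((E → Bool) × (J → E → Bool))) × (J → E)) :=
    inferInstance
  have hd3 : DiscreteMeasurableSpace (V → ((E → Bool) × ((E → Bool) × (J → E → Bool)))) :=
    inferInstance
  have hb := bern_prob p hp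
  have hb1 := bern_prob p1 hp1
  have hb2 := bern_prob q2 hq2
  have hb3 := bern_prob q3 hq3
  have hun : ∀ v, IsProbabilityMeasure (unifF (star v)) := fun v => unifF_prob _ (hstar v)
  set A : Finset V → V → Finset E := fun b v => (star v).filter (fun e => owner b e = v) with hA
  have hC := fun (b : Finset V) (v : V) => coupC (J := J) p1 q2 q3 hp1 hq2 hq3 (star v) (A b v)
    (hstar v) (Finset.filter_subset _ _) δ (v ∈ b) ((b.card : ℝ≥0∞) ≤ L)
    (fun h1 h2 => hne b h1 v h2) (fun h1 h2 => hδ b h1 v h2) (fun h1 h2 => h3 b h1 v h2)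
  choose C hCf hC1 hC2 hC3 using hC
  let few : V → Set (E → Bool) := fun v => fewV (star v) (Fintype.card J)
  let μ2 := Measure.pi fun _ : E => bern q2
  let c : Finset V → V → ℝ≥0∞ := fun b v => μ2 {x | x ∈ few v ↔ v ∈ b}
  let MW : Measure ((E → Bool) × ((E → Bool) × (J → E → Bool))) :=
    (Measure.pi fun _ : E => bern p1).prod
        ((Measure.pi fun _ : E => bern q2).prod
          (Measure.pi fun _ : J => Measure.pi fun _ : E => bern q3))
  let D : Finset V → V → Set ((E → Bool) × ((E → Bool) × (J → E → Bool))) := fun b v =>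
    {w | w.2.1 ∈ few v ↔ v ∈ b}
  have hMW : ∀ b v, (C b v).map Prod.fst = MW.restrict (D b v) := by
    intro b v
    have : D b v = Set.univ ×ˢ ({x | x ∈ few v ↔ v ∈ b} ×ˢ Set.univ) := by
      ext w; simp [D]
    rw [hC1, this, ← Measure.prod_restrict, ← Measure.prod_restrict, Measure.restrict_univ,
      Measure.restrict_univ]
  have hCu : ∀ b v, C b v Set.univ = c b v := by
    intro b v
    have := congrArg (fun m => m Set.univ) (hC2 b v)
    simpa [Measure.map_apply .of_discrete .of_discrete] using this
  let B0 : (V → (E → Bool) × (J → E → Bool)) → Finset V := fun w =>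
    Finset.univ.filter (fun v => (w v).1 ∈ few v)
  let B : (V → (E → Bool) × ((E → Bool) × (J → E → Bool))) → Finset V := fun w =>
    B0 (fun v => (w v).2)
  have hBD : ∀ b, Set.univ.pi (D b) = B ⁻¹' {b} := by
    intro b
    ext w
    simp only [Set.mem_pi, Set.mem_univ, forall_true_left, D, B, B0, Set.mem_preimage,
      Set.mem_singleton_iff, Finset.ext_iff, Finset.mem_filter, Finset.mem_univ, true_and,
      Set.mem_setOf_eq]
  let Q : Finset V → Measure (V → ((E → Bool) × ((E → Bool) × (J → E → Bool))) × (J → E)) :=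
    fun b => Measure.pi (C b)
  have hQ1 : ∀ b, (Q b).map (fun z v => (z v).1) = (Measure.pi fun _ : V => MW).restrict (B ⁻¹' {b}) := by
    intro b
    rw [← hBD, Measure.restrict_pi_pi]
    simp only [Q]
    rw [Measure.pi_map_pi (f := fun _ => Prod.fst) (hμ := fun i => inferInstance)
      (fun _ => Measurable.of_discrete.aemeasurable)]
    congr 1
    funext v
    exact hMW b v
  have hQ2 : ∀ b, (Q b).map (fun z v => (z v).2) = (∏ v, c b v) •
      Measure.pi (fun v : V => Measure.pi fun _ : J => unifF (star v)) := by
    intro b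
    simp only [Q]
    rw [Measure.pi_map_pi (f := fun _ => Prod.snd) (hμ := fun i => inferInstance)
      (fun _ => Measurable.of_discrete.aemeasurable)]
    simp_rw [hC2]
    exact pi_smul_const (c b) (fun _ => measure_ne_top _ _) _
  have hw : ∀ b, (Measure.pi fun _ : V => MW) (B ⁻¹' {b}) = ∏ v, c b v := by
    intro b
    have h1 : Q b Set.univ = ∏ v, c b v := by
      simp only [Q]
      rw [Measure.pi_univ]
      exact Finset.prod_congr rfl fun v _ => hCu b v
    rw [← h1]
    have := congrArg (fun m => m Set.univ) (hQ1 b)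
    have e : (Q b).map (fun z v => (z v).1) Set.univ = Q b Set.univ := by
      rw [Measure.map_apply .of_discrete .univ, Set.preimage_univ]
    rw [← e]
    simpa using this.symm
  have hwsum : ∀ s, ∑ b, (Measure.pi fun _ : V => MW) (s ∩ B ⁻¹' {b}) = (Measure.pi fun _ : V => MW) s := by
    intro s
    conv_rhs => rw [← sum_restrict_fiber (Measure.pi fun _ : V => MW) B]
    rw [Measure.finset_sum_apply]
    exact Finset.sum_congr rfl fun b _ => (Measure.restrict_apply .of_discrete).symm
  have hw1 : ∑ b, ∏ v, c b v = 1 := by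
    simp_rw [← hw]
    have := hwsum Set.univ
    simpa using this
  let h : Finset V → (V → ((E → Bool) × ((E → Bool) × (J → E → Bool))) × (J → E)) →
    (E → Bool) × (V → J → E) := fun b z =>
      (hyp star owner b (fun v => (z v).1), fun v => (z v).2)
  refine ⟨∑ b, (Q b).map (h b), ?_, ?_, ?_⟩
  · rw [map_finset_sum' _ _ _ .of_discrete, ← hyp_law (J := J) star owner r hinc p p1 q2 q3 hp hp1 hq2 hq3 hpp B0]
    have := sum_restrict_map (Measure.pi fun _ : V => MW) B (fun b w => hyp star owner b w)
    refine Eq.trans (Finset.sum_congr rfl fun b _ => ?_) this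
    rw [Measure.map_map .of_discrete .of_discrete, ← hQ1, Measure.map_map .of_discrete .of_discrete]
    rfl
  · rw [map_finset_sum' _ _ _ .of_discrete]
    have : ∀ b, ((Q b).map (h b)).map Prod.snd = (∏ v, c b v) •
      Measure.pi (fun v : V => Measure.pi fun _ : J => unifF (star v)) := by
      intro b
      rw [← hQ2, Measure.map_map .of_discrete .of_discrete]
      rfl
    simp_rw [this]
    rw [← Finset.sum_smul, hw1, one_smul]
  · rw [Measure.finset_sum_apply]
    have hsmall : ∀ b : Finset V, (b.card : ℝ≥0∞) ≤ L →
        (Q b).map (h b) {z | ¬ ∀ v j, z.1 (z.2 v j) = true} ≤ Fintype.card V * δ * ∏ v, c b v := by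
      intro b hbL
      rw [Measure.map_apply .of_discrete .of_discrete]
      let T : V → Set (((E → Bool) × ((E → Bool) × (J → E → Bool))) × (J → E)) := fun v =>
        badV (A b v) ∪ {z | ¬ ∀ j, z.2 j ∈ star v}
      have hT : ∀ v, C b v (T v) ≤ δ * c b v := by
        intro v
        refine (measure_union_le _ _).trans ?_
        have : C b v {z | ¬ ∀ j, z.2 j ∈ star v} = 0 := by
          have e : C b v {z | ¬ ∀ j, z.2 j ∈ star v} =
            (C b v).map Prod.snd {f | ¬ ∀ j, f j ∈ star v} := by
            rw [Measure.map_apply .of_discrete .of_discrete]; rfl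
          rw [e, hC2, Measure.smul_apply, pi_unif_null, smul_zero]
        rw [this, add_zero]
        exact hC3 b v hbL
      have hsub : h b ⁻¹' {z | ¬ ∀ v j, z.1 (z.2 v j) = true} ⊆ ⋃ v, {z | z v ∈ T v} := by
        intro z hz
        by_contra hcon
        apply hz
        intro v j
        simp only [Set.mem_iUnion, not_exists, Set.mem_setOf_eq, T, Set.mem_union, not_or,
          badV, not_not] at hcon
        obtain ⟨k1, k2⟩ := hcon v
        have k1 := k1 j
        have k2 := k2 j
        simp only [h, hyp, decide_eq_true_eq]
        rcases k1 with ⟨k1, k3⟩ | k1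
        · left
          have : owner b ((z v).2 j) = v := (Finset.mem_filter.1 k1).2
          rw [this]; exact k3
        · right
          refine ⟨v, k2, ?_⟩
          rcases k1 with k1 | k1
          · exact Or.inl k1
          · exact Or.inr ⟨j, k1⟩
      refine (measure_mono hsub).trans ((measure_iUnion_fintype_le _ _).trans ?_)
      have : ∀ v, Q b {z | z v ∈ T v} ≤ δ * ∏ v, c b v := by
        intro v
        have e : {z : V → ((E → Bool) × ((E → Bool) × (J → E → Bool))) × (J → E) | z v ∈ T v} =
            Set.univ.pi (Function.update (fun _ => Set.univ) v (T v)) := by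
          ext z
          simp only [Set.mem_setOf_eq, Set.mem_pi, Set.mem_univ, forall_true_left]
          constructor
          · intro hz u
            by_cases hu : u = v
            · subst hu; simpa using hz
            · simp [hu]
          · intro hz; simpa using hz v
        simp only [Q]
        rw [e, Measure.pi_pi]
        have : δ * ∏ u, c b u = ∏ u, ((if u = v then δ else 1) * c b u) := by
          rw [Finset.prod_mul_distrib, Finset.prod_ite_eq']; simp
        rw [this]
        apply Finset.prod_le_prod'
        intro u _
        by_cases hu : u = v
        · subst hu; simpa using hT u
        · simp [hu, hCu]
      refine (Finset.sum_le_sum fun v _ => this v).trans ?_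
      simp [mul_assoc]
    have hall : ∀ b : Finset V, 
        (Q b).map (h b) {z | ¬ ∀ v j, z.1 (z.2 v j) = true} ≤
          (b.card : ℝ≥0∞) / L * (∏ v, c b v) + Fintype.card V * δ * ∏ v, c b v := by
      intro b
      by_cases hbL : (b.card : ℝ≥0∞) ≤ L
      · exact (hsmall b hbL).trans le_add_self
      · refine le_trans ?_ le_self_add
        push Not at hbL
        have h1 : (1:ℝ≥0∞) ≤ b.card / L := by
          rw [ENNReal.le_div_iff_mul_le (Or.inl hL) (Or.inl hL')]
          simpa using hbL.le
        calc _ ≤ (Q b).map (h b) Set.univ := measure_mono (Set.subset_univ _)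
          _ = ∏ v, c b v := by
              rw [Measure.map_apply .of_discrete .univ, Set.preimage_univ]
              simp only [Q]
              rw [Measure.pi_univ]
              exact Finset.prod_congr rfl fun v _ => hCu b v
          _ ≤ _ := le_mul_of_one_le_left zero_le h1
    refine (Finset.sum_le_sum fun b _ => hall b).trans ?_
    rw [Finset.sum_add_distrib, ← Finset.mul_sum, hw1, mul_one]
    gcongr
    have hv : ∀ v, ∑ b : Finset V, (if v ∈ b then ∏ v, c b v else 0) ≤ β := by
      intro v
      calc ∑ b : Finset V, (if v ∈ b then ∏ v, c b v else 0) =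
          ∑ b, (Measure.pi fun _ : V => MW) ({w | v ∈ B w} ∩ B ⁻¹' {b}) := by
            refine Finset.sum_congr rfl fun b _ => ?_
            split_ifs with hvb
            · rw [← hw]; congr 1; ext w
              simp only [Set.mem_preimage, Set.mem_singleton_iff, Set.mem_inter_iff, Set.mem_setOf_eq]
              constructor
              · intro e; exact ⟨e ▸ hvb, e⟩
              · exact fun e => e.2
            · symm; convert measure_empty (μ := Measure.pi fun _ : V => MW)
              ext w
              simp only [Set.mem_preimage, Set.mem_singleton_iff, Set.mem_inter_iff, Set.mem_setOf_eq,
                Set.mem_empty_iff_false, iff_false, not_and]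
              intro h1 h2; exact hvb (h2 ▸ h1)
        _ = (Measure.pi fun _ : V => MW) {w | v ∈ B w} := hwsum _
        _ = (Measure.pi fun _ : V => MW).map (Function.eval v) {w | w.2.1 ∈ few v} := by
            rw [Measure.map_apply .of_discrete .of_discrete]
            congr 1; ext w; simp [B, B0]
        _ = MW (Set.univ ×ˢ (few v ×ˢ Set.univ)) := by
            rw [(measurePreserving_eval (fun _ : V => MW) v).map_eq]
            congr 1; ext w; simp
        _ = μ2 (few v) := by
            simp only [MW]
            rw [Measure.prod_prod, Measure.prod_prod]; simp [μ2]
        _ ≤ β := hβ v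
    calc ∑ b : Finset V, (b.card : ℝ≥0∞) / L * ∏ v, c b v
        = (∑ b : Finset V, ∑ v, (if v ∈ b then ∏ v, c b v else 0)) / L := by
          rw [ENNReal.div_eq_inv_mul, Finset.mul_sum]
          refine Finset.sum_congr rfl fun b _ => ?_
          rw [Finset.sum_ite_mem]
          simp [ENNReal.div_eq_inv_mul, mul_assoc]
      _ ≤ _ := by
          rw [Finset.sum_comm]
          gcongr
          refine (Finset.sum_le_sum fun v _ => hv v).trans ?_
          simp

end Part6

section Part7

variable {E : Type*} [Fintype E]

lemma bern_integral (q : ℝ) (h0 : 0 ≤ q) (h1 : q ≤ 1) (f : Bool → ℝ) :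
    ∫ x, f x ∂(bern (ENNReal.ofReal q)) = q * f true + (1 - q) * f false := by
  have hb := bern_prob (ENNReal.ofReal q) (by simpa using h1)
  rw [integral_fintype .of_finite]
  simp only [Fintype.sum_bool, Measure.real, bern_true, bern_false, smul_eq_mul]
  rw [ENNReal.toReal_ofReal h0, ENNReal.toReal_sub_of_le (by simpa using h1) (by simp),
    ENNReal.toReal_ofReal h0]
  simp

lemma chernoff (q : ℝ) (h0 : 0 ≤ q) (h1 : q ≤ 1) (s : ℝ) (hs0 : 0 < s) (hs1 : s < 1)
    (A : Finset E) (m : ℕ) :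
    (Measure.pi fun _ : E => bern (ENNReal.ofReal q)) (fewV A m) ≤
      ENNReal.ofReal (Real.exp (-(q * A.card * (1 - s))) / s ^ m) := by
  have hb := bern_prob (ENNReal.ofReal q) (by simpa using h1)
  set μ := Measure.pi fun _ : E => bern (ENNReal.ofReal q) with hμ
  let f : E → Bool → ℝ := fun e b => if e ∈ A ∧ b = true then s else 1
  have hf : ∀ x : E → Bool, ∏ e, f e (x e) = s ^ (A.filter (fun e => x e = true)).card := by
    intro x
    simp only [f]
    rw [Finset.prod_ite]
    simp only [Finset.prod_const, one_pow, mul_one]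
    congr 2
    ext e; simp
  have hI : ∫ x, ∏ e, f e (x e) ∂μ ≤ Real.exp (-(q * A.card * (1 - s))) := by
    rw [hμ, integral_fintype_prod_eq_prod]
    have : ∀ e, ∫ x, f e x ∂(bern (ENNReal.ofReal q)) ≤
        if e ∈ A then Real.exp (-(q * (1 - s))) else 1 := by
      intro e
      rw [bern_integral q h0 h1]
      by_cases he : e ∈ A
      · simp only [f, he, true_and, if_true]
        have := Real.add_one_le_exp (-(q * (1 - s)))
        simp
        linarith
      · simp [f, he]
    have h2 : ∀ e, 0 ≤ ∫ x, f e x ∂(bern (ENNReal.ofReal q)) := by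
      intro e
      apply integral_nonneg
      intro x
      simp only [f]
      split_ifs <;> simp [hs0.le]
    refine (Finset.prod_le_prod (fun e _ => h2 e) fun e _ => this e).trans ?_
    rw [Finset.prod_ite_mem]
    simp only [Finset.univ_inter, Finset.prod_const]
    rw [← Real.exp_nat_mul]
    apply le_of_eq
    congr 1; ring
  have hM := mul_meas_ge_le_integral_of_nonneg (μ := μ) (f := fun x => ∏ e, f e (x e))
    (ae_of_all _ fun x => by simp only [hf]; positivity) .of_finite (s ^ m)
  have hsub : fewV A m ⊆ {x | s ^ m ≤ ∏ e, f e (x e)} := by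
    intro x hx
    simp only [Set.mem_setOf_eq, hf]
    exact pow_le_pow_of_le_one hs0.le hs1.le (le_of_lt hx)
  refine (measure_mono hsub).trans ?_
  rw [← ENNReal.ofReal_toReal (measure_ne_top μ _)]
  apply ENNReal.ofReal_le_ofReal
  rw [le_div_iff₀ (by positivity)]
  rw [mul_comm]
  exact hM.trans hI

lemma bern_exists (q : ℝ≥0∞) (hq : q ≤ 1) (F : Finset E) :
    (Measure.pi fun _ : E => bern q) {x | ∃ e ∈ F, x e = true} = 1 - (1 - q) ^ F.card := by
  have hb := bern_prob q hq
  have h : {x : E → Bool | ∃ e ∈ F, x e = true} =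
      (Set.univ.pi fun e => if e ∈ F then {false} else Set.univ)ᶜ := by
    ext x
    simp only [Set.mem_setOf_eq, Set.mem_compl_iff, Set.mem_pi, Set.mem_univ, forall_true_left,
      not_forall]
    refine exists_congr fun e => ?_
    by_cases he : e ∈ F <;> simp [he]
  rw [h, prob_compl_eq_one_sub .of_discrete, Measure.pi_pi]
  congr 1
  have : ∀ e, bern q (if e ∈ F then {false} else Set.univ) = if e ∈ F then 1 - q else 1 := by
    intro e
    split_ifs
    · exact bern_false q
    · exact measure_univ
  simp only [this]
  rw [Finset.prod_ite_mem]; simp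

lemma exp_neg_le_half (t : ℝ) (h0 : 0 ≤ t) (h1 : t ≤ 1) : Real.exp (-t) ≤ 1 - t / 2 := by
  have h2 : 0 < 1 + t := by linarith
  have := Real.add_one_le_exp t
  rw [Real.exp_neg]
  have h3 : (Real.exp t)⁻¹ ≤ (1 + t)⁻¹ := inv_anti₀ h2 (by linarith)
  refine h3.trans ?_
  rw [inv_le_iff_one_le_mul₀ h2]
  nlinarith

lemma q3_lemma [MeasurableSpace E] [DiscreteMeasurableSpace E] (S F : Finset E) (N : ℕ)
    (hN : S.card = N) (hN2 : 2 ≤ N) (hF : F ⊆ S) (hk : 2 * F.card ≤ N) :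
    unifF S (F : Set E) ≤
      (Measure.pi fun _ : E => bern (ENNReal.ofReal (2 / N))) {x | ∃ e ∈ F, x e = true} := by
  have hN0 : (0:ℝ) < N := by positivity
  have hN2' : (2:ℝ) ≤ N := by exact_mod_cast hN2
  have hk' : 2 * (F.card : ℝ) ≤ N := by exact_mod_cast hk
  have hq : (2:ℝ) / N ≤ 1 := by rw [div_le_one hN0]; exact hN2'
  have hq0 : (0:ℝ) ≤ 2 / N := by positivity
  rw [bern_exists _ (by simpa using hq), unifF_apply, Finset.inter_eq_left.2 hF, hN]
  have e1 : (N : ℝ≥0∞)⁻¹ * F.card = ENNReal.ofReal (F.card / N) := by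
    rw [ENNReal.ofReal_div_of_pos hN0, ENNReal.div_eq_inv_mul]; simp
  have e2 : (1:ℝ≥0∞) - (1 - ENNReal.ofReal (2 / N)) ^ F.card =
      ENNReal.ofReal (1 - (1 - 2 / N) ^ F.card) := by
    rw [ENNReal.ofReal_sub _ (by apply pow_nonneg; linarith), ENNReal.ofReal_pow (by linarith),
      ENNReal.ofReal_sub _ hq0, ENNReal.ofReal_one]
  rw [e1, e2]
  apply ENNReal.ofReal_le_ofReal
  have h1 : (1 - 2 / (N:ℝ)) ^ F.card ≤ Real.exp (-(2 * F.card / N)) := by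
    have := Real.one_sub_le_exp_neg (2 / (N:ℝ))
    refine (pow_le_pow_left₀ (by linarith) this _).trans (le_of_eq ?_)
    rw [← Real.exp_nat_mul]; congr 1; ring
  have h2 := exp_neg_le_half (2 * F.card / N) (by positivity) (by rw [div_le_one hN0]; exact hk')
  have : 2 * (F.card:ℝ) / N / 2 = F.card / N := by ring
  linarith

end Part7

section Part8

instance discFin {n : ℕ} : DiscreteMeasurableSpace (Finset (Fin n)) := ⟨fun _ => trivial⟩

lemma card_super (r n : ℕ) (T : Finset (Fin n)) (hT : T.card ≤ r) :
    (Finset.univ.filter (fun e : Edge r n => T ⊆ e.1)).card = (n - T.card).choose (r - T.card) := by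
  have : (n - T.card).choose (r - T.card) =
      (Finset.powersetCard (r - T.card) (Tᶜ)).card := by
    rw [Finset.card_powersetCard, Finset.card_compl, Fintype.card_fin]
  rw [this]
  refine Finset.card_bij (fun e _ => e.1 \ T) ?_ ?_ ?_
  · intro e he
    rw [Finset.mem_filter] at he
    rw [Finset.mem_powersetCard]
    refine ⟨fun x hx => by simp at hx ⊢; exact hx.2, ?_⟩
    rw [Finset.card_sdiff_of_subset he.2, e.2]
  · intro e he f hf hef
    rw [Finset.mem_filter] at he hf
    apply Subtype.ext
    rw [← Finset.sdiff_union_of_subset he.2, ← Finset.sdiff_union_of_subset hf.2, hef]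
  · intro c hc
    rw [Finset.mem_powersetCard] at hc
    have hd : Disjoint c T := by
      rw [Finset.disjoint_left]; intro x hx
      simpa using hc.1 hx
    refine ⟨⟨c ∪ T, ?_⟩, ?_, ?_⟩
    · rw [Finset.card_union_of_disjoint hd, hc.2]; omega
    · simp
    · simp [Finset.union_sdiff_cancel_right hd]

noncomputable def starE (r n : ℕ) (v : Fin n) : Finset (Edge r n) :=
  Finset.univ.filter (fun e => v ∈ e.1)

lemma mem_starE (r n : ℕ) (v : Fin n) (e : Edge r n) : e ∈ starE r n v ↔ v ∈ e.1 := by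
  simp [starE]

lemma card_starE (r n : ℕ) (hr : 2 ≤ r) (v : Fin n) :
    (starE r n v).card = (n - 1).choose (r - 1) := by
  have := card_super r n {v} (by simp; omega)
  simpa [starE] using this

noncomputable def ownerE (r n : ℕ) [NeZero n] (b : Finset (Fin n)) (e : Edge r n) : Fin n :=
  if h : (e.1 ∩ b).Nonempty then h.choose else 0

lemma exc_card (r n : ℕ) [NeZero n] (hr : 2 ≤ r) (b : Finset (Fin n)) (v : Fin n) (hv : v ∈ b) :
    (starE r n v \ (starE r n v).filter (fun e => ownerE r n b e = v)).card ≤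
      b.card * (n - 2).choose (r - 2) := by
  have hsub : starE r n v \ (starE r n v).filter (fun e => ownerE r n b e = v) ⊆
      (b.erase v).biUnion (fun u => Finset.univ.filter (fun e : Edge r n => {u, v} ⊆ e.1)) := by
    intro e he
    simp only [Finset.mem_sdiff, Finset.mem_filter, mem_starE, not_and] at he
    obtain ⟨h1, h2⟩ := he
    have hne : (e.1 ∩ b).Nonempty := ⟨v, by simp [h1, hv]⟩
    have h3 : ownerE r n b e = hne.choose := by simp [ownerE, hne]
    have h4 := hne.choose_spec
    rw [← h3, Finset.mem_inter] at h4
    rw [Finset.mem_biUnion]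
    refine ⟨ownerE r n b e, by simp [h2 h1, h4.2], ?_⟩
    simp only [Finset.mem_filter, Finset.mem_univ, true_and]
    intro x hx
    rcases Finset.mem_insert.1 hx with rfl | hx
    · exact h4.1
    · rw [Finset.mem_singleton.1 hx]; exact h1
  refine (Finset.card_le_card hsub).trans ?_
  refine (Finset.card_biUnion_le_card_mul _ _ ((n - 2).choose (r - 2)) ?_).trans ?_
  · intro u hu
    have huv : u ≠ v := (Finset.mem_erase.1 hu).1
    have := card_super r n {u, v} (by rw [Finset.card_pair huv]; exact hr)
    rw [Finset.card_pair huv] at this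
    exact this.le
  · exact Nat.mul_le_mul_right _ (Finset.card_le_card (Finset.erase_subset _ _))

lemma choose_rel (r n : ℕ) (hr : 2 ≤ r) (hn : r ≤ n) :
    (n - 1) * (n - 2).choose (r - 2) = (n - 1).choose (r - 1) * (r - 1) := by
  obtain ⟨r, rfl⟩ := Nat.exists_eq_add_of_le hr
  obtain ⟨n, rfl⟩ := Nat.exists_eq_add_of_le (hr.trans hn)
  have := Nat.add_one_mul_choose_eq n r
  simpa [show 2 + n - 1 = n + 1 by omega, show 2 + r - 1 = r + 1 by omega] using this

lemma inc_card (r n : ℕ) (e : Edge r n) :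
    (Finset.univ.filter (fun v => e ∈ starE r n v)).card = r := by
  simp only [mem_starE]
  have : Finset.univ.filter (fun v => v ∈ e.1) = e.1 := by ext; simp
  rw [this, e.2]

/-- conversion of pick families to `Picks` -/
noncomputable def convP (r n ρ d : ℕ) (h : ∀ v : Fin n, Nonempty {e : Finset (Fin n) // e.card = r ∧ v ∈ e})
    (f : Fin n → Fin ρ × Fin d → Edge r n) : Fin ρ → Picks r n d := fun i v j =>
  if hv : v ∈ (f v (i, j)).1 then ⟨(f v (i, j)).1, (f v (i, j)).2, hv⟩ else (h v).some

lemma null_off (r n ρ d : ℕ) (hr : 2 ≤ r) (hn : r ≤ n) :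
    (Measure.pi (fun v : Fin n => Measure.pi fun _ : Fin ρ × Fin d => unifF (starE r n v)))
      {f | ¬ ∀ v j, v ∈ (f v j).1} = 0 := by
  have hne : ∀ v, (starE r n v).Nonempty := fun v => by
    rw [← Finset.card_pos, card_starE r n hr v]; exact Nat.choose_pos (by omega)
  have hp : ∀ v, IsProbabilityMeasure (unifF (starE r n v)) := fun v => unifF_prob _ (hne v)
  have : {f : Fin n → Fin ρ × Fin d → Edge r n | ¬ ∀ v j, v ∈ (f v j).1} =
      ⋃ v, Function.eval v ⁻¹' {g | ¬ ∀ j, g j ∈ starE r n v} := by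
    ext f; simp [mem_starE]
  rw [this, measure_iUnion_null_iff]
  intro v
  exact Measure.pi_eval_preimage_null _ (pi_unif_null _)

lemma card_sub (r n : ℕ) (hr : 2 ≤ r) (v : Fin n) :
    Fintype.card {e : Finset (Fin n) // e.card = r ∧ v ∈ e} = (n - 1).choose (r - 1) := by
  rw [← card_starE r n hr v, ← Fintype.card_coe]
  refine Fintype.card_congr ⟨fun e => ⟨⟨e.1, e.2.1⟩, (mem_starE _ _ _ _).2 e.2.2⟩,
    fun e => ⟨e.1.1, e.1.2, (mem_starE _ _ _ _).1 e.2⟩, fun _ => rfl, fun _ => rfl⟩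

lemma card_picks (r n d : ℕ) (hr : 2 ≤ r) :
    Fintype.card (Picks r n d) = ((n - 1).choose (r - 1)) ^ (d * n) := by
  rw [Fintype.card_pi]
  simp only [Fintype.card_fun, card_sub r n hr, Fintype.card_fin]
  simp [← pow_mul]

lemma picks_prob (r n d : ℕ) (hr : 2 ≤ r) (hn : r ≤ n) : IsProbabilityMeasure (uniformPicks r n d) := by
  constructor
  have h : (n - 1).choose (r - 1) ≠ 0 := (Nat.choose_pos (by omega)).ne'
  simp only [uniformPicks, Measure.smul_apply, smul_eq_mul]
  rw [Measure.count_apply .univ, Set.encard_univ, ENat.card_eq_coe_fintype_card]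
  simp only [ENat.toENNReal_coe]
  refine ENNReal.inv_mul_cancel ?_ (ENNReal.natCast_ne_top _)
  rw [card_picks r n d hr]
  simp [h]

instance countP (r n d : ℕ) : Countable (Picks r n d) := Finite.to_countable

instance discP (r n ρ d : ℕ) : DiscreteMeasurableSpace (Fin ρ → Picks r n d) := inferInstance

lemma conv_law (r n ρ d : ℕ) (hr : 2 ≤ r) (hn : r ≤ n)
    (h : ∀ v : Fin n, Nonempty {e : Finset (Fin n) // e.card = r ∧ v ∈ e}) :
    (Measure.pi (fun v : Fin n => Measure.pi fun _ : Fin ρ × Fin d => unifF (starE r n v))).map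
      (convP r n ρ d h) = Measure.pi (fun _ : Fin ρ => uniformPicks r n d) := by
  have hne : ∀ v, (starE r n v).Nonempty := fun v => by
    rw [← Finset.card_pos, card_starE r n hr v]; exact Nat.choose_pos (by omega)
  have hp : ∀ v, IsProbabilityMeasure (unifF (starE r n v)) := fun v => unifF_prob _ (hne v)
  have hpp := picks_prob r n d hr hn
  apply Measure.ext_of_singleton
  intro g
  rw [Measure.map_apply .of_discrete .of_discrete, Measure.pi_singleton]
  let G : Fin n → Fin ρ × Fin d → Edge r n := fun v x => ⟨(g x.1 v x.2).1, (g x.1 v x.2).2.1⟩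
  have h1 : (Measure.pi (fun v : Fin n => Measure.pi fun _ : Fin ρ × Fin d => unifF (starE r n v)))
      (convP r n ρ d h ⁻¹' {g}) =
      (Measure.pi (fun v : Fin n => Measure.pi fun _ : Fin ρ × Fin d => unifF (starE r n v))) {G} := by
    apply le_antisymm
    · have hs : convP r n ρ d h ⁻¹' {g} ⊆ {G} ∪ {f | ¬ ∀ v j, v ∈ (f v j).1} := by
        intro f hf
        by_cases hv : ∀ v j, v ∈ (f v j).1
        · left
          have hf : convP r n ρ d h f = g := hf
          simp only [Set.mem_singleton_iff]
          funext v x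
          apply Subtype.ext
          simp only [G, ← hf, convP, hv, dif_pos]
        · right; exact hv
      refine (measure_mono hs).trans ((measure_union_le _ _).trans ?_)
      rw [null_off r n ρ d hr hn, add_zero]
    · apply measure_mono
      rintro f rfl
      simp only [Set.mem_preimage, Set.mem_singleton_iff]
      funext i v j
      have : v ∈ (g i v j).1 := (g i v j).2.2
      simp only [convP, G, this, dif_pos]
  rw [h1, Measure.pi_singleton]
  simp only [Measure.pi_singleton]
  have h2 : ∀ v x, unifF (starE r n v) {G v x} = (((n - 1).choose (r - 1) : ℕ) : ℝ≥0∞)⁻¹ := by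
    intro v x
    have hm : G v x ∈ starE r n v := (mem_starE _ _ _ _).2 (g x.1 v x.2).2.2
    rw [unifF_singleton, if_pos hm, card_starE r n hr v]
  have h3 : ∀ i, uniformPicks r n d {g i} = ((((n - 1).choose (r - 1) : ℕ) : ℝ≥0∞)⁻¹) ^ (d * n) := by
    intro i
    simp only [uniformPicks, Measure.smul_apply, smul_eq_mul, Measure.count_singleton, mul_one]
    rw [card_picks r n d hr, Nat.cast_pow, ENNReal.inv_pow]
  simp only [h2, h3]
  simp only [Finset.prod_const, ← pow_mul, Finset.card_univ, Fintype.card_prod, Fintype.card_fin]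
  congr 1; ring

end Part8

section Part9

lemma sdiff_sub_cl {α : Type*} (s t : Finset α) : s \ t ⊆ s := Finset.sdiff_subset

lemma graphThm (r n ρ d : ℕ) (hr : 2 ≤ r) (hn : r ≤ n)
    (p p1 q2 η κ s1 s2 : ℝ) (hp0 : 0 ≤ p) (hp : p ≤ 1) (hp10 : 0 ≤ p1) (hp1 : p1 ≤ 1)
    (hq20 : 0 ≤ q2) (hq2 : q2 ≤ 1) (hN : 2 ≤ (n - 1).choose (r - 1))
    (hpp : (1 - p1) * ((1 - q2) * (1 - 2 / ((n - 1).choose (r - 1) : ℕ)) ^ (ρ * d)) ^ r = 1 - p)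
    (hη : 0 < η) (hκ : 2 * η * r ≤ κ) (hκ2 : κ ≤ 1 / 2)
    (hs1 : 0 < s1) (hs1' : s1 < 1) (hs2 : 0 < s2) (hs2' : s2 < 1) :
    ∃ π : Measure ((Edge r n → Bool) × (Fin ρ → Picks r n d)),
      π.map Prod.fst = Measure.pi (fun _ : Edge r n => bern (ENNReal.ofReal p)) ∧
      π.map Prod.snd = Measure.pi (fun _ : Fin ρ => uniformPicks r n d) ∧
      π {ω | ¬ ∀ (i : Fin ρ) (v : Fin n) (j : Fin d),
                ω.1 ⟨(ω.2 i v j).1, (ω.2 i v j).2.1⟩ = true} ≤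
        ENNReal.ofReal
          (Real.exp (-(q2 * ((n - 1).choose (r - 1) : ℕ) * (1 - s2))) / s2 ^ (ρ * d) / η +
          n * (Real.exp (-(p1 * ((1 - κ) * ((n - 1).choose (r - 1) : ℕ)) * (1 - s1))) / s1 ^ (ρ * d))) := by
  have hn0 : NeZero n := ⟨by omega⟩
  set N := (n - 1).choose (r - 1) with hNdef
  have hN0 : (0:ℝ) < N := by positivity
  have hN2' : (2:ℝ) ≤ N := by exact_mod_cast hN
  have hnpos : (0:ℝ) < n := by have : 0 < n := by omega
                               exact_mod_cast this
  have hq3 : (2:ℝ) / N ≤ 1 := by rw [div_le_one hN0]; exact hN2'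
  have hne : ∀ v, (starE r n v).Nonempty := fun v => by
    rw [← Finset.card_pos, card_starE r n hr v]; omega
  have hcJ : Fintype.card (Fin ρ × Fin d) = ρ * d := by simp
  -- exceptional sets are small
  have hexc : ∀ b : Finset (Fin n), (b.card : ℝ≥0∞) ≤ ENNReal.ofReal (η * n) → ∀ v ∈ b,
      ((starE r n v \ (starE r n v).filter (fun e => ownerE r n b e = v)).card : ℝ) ≤ κ * N := by
    intro b hb v hv
    have hb' : (b.card : ℝ) ≤ η * n := by
      rw [ENNReal.le_ofReal_iff_toReal_le (by simp) (by positivity)] at hb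
      simpa using hb
    have h1 : ((starE r n v \ (starE r n v).filter (fun e => ownerE r n b e = v)).card : ℝ) ≤
        b.card * (n - 2).choose (r - 2) := by exact_mod_cast exc_card r n hr b v hv
    have h2 : ((n - 1 : ℕ) : ℝ) * (n - 2).choose (r - 2) = N * (r - 1 : ℕ) := by
      exact_mod_cast choose_rel r n hr hn
    rw [Nat.cast_sub (by omega), Nat.cast_sub (by omega)] at h2
    push_cast at h2
    have hc0 : (0:ℝ) ≤ (n - 2).choose (r - 2) := by positivity
    have hn2 : (2:ℝ) ≤ n := by exact_mod_cast hr.trans hn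
    have h3 : (n:ℝ) * (n - 2).choose (r - 2) ≤ 2 * (r * N) := by nlinarith
    calc _ ≤ (b.card : ℝ) * (n - 2).choose (r - 2) := h1
      _ ≤ η * n * (n - 2).choose (r - 2) := by gcongr
      _ = η * (n * (n - 2).choose (r - 2)) := by ring
      _ ≤ η * (2 * (r * N)) := by gcongr
      _ = (2 * η * r) * N := by ring
      _ ≤ κ * N := by gcongr
  have hAc : ∀ b : Finset (Fin n), (b.card : ℝ≥0∞) ≤ ENNReal.ofReal (η * n) → ∀ v ∈ b,
      (1 - κ) * N ≤ (((starE r n v).filter (fun e => ownerE r n b e = v)).card : ℝ) := by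
    intro b hb v hv
    have h1 := hexc b hb v hv
    have h2 := Finset.card_sdiff_add_card_eq_card
      (Finset.filter_subset (fun e => ownerE r n b e = v) (starE r n v))
    rw [card_starE r n hr v] at h2
    have h3 : ((starE r n v \ (starE r n v).filter (fun e => ownerE r n b e = v)).card : ℝ) +
      ((starE r n v).filter (fun e => ownerE r n b e = v)).card = N := by exact_mod_cast h2
    linarith
  obtain ⟨π, h1, h2, h3⟩ := absThm (J := Fin ρ × Fin d) (starE r n) hne (ownerE r n) r
    (fun e => by convert inc_card r n e) (ENNReal.ofReal p) (ENNReal.ofReal p1) (ENNReal.ofReal q2)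
    (ENNReal.ofReal (2 / N)) (by simpa using hp) (by simpa using hp1) (by simpa using hq2)
    (by simpa using hq3)
    (by
      have e : ∀ x : ℝ, 0 ≤ x → (1:ℝ≥0∞) - ENNReal.ofReal x = ENNReal.ofReal (1 - x) := by
        intro x hx; rw [ENNReal.ofReal_sub _ hx, ENNReal.ofReal_one]
      have h3 : 0 ≤ 1 - 2 / (N:ℝ) := by linarith
      have h4 : 0 ≤ 1 - q2 := by linarith
      have h5 : 0 ≤ 1 - p1 := by linarith
      rw [hcJ, e p1 hp10, e q2 hq20, e _ (by positivity), e p hp0, ← hpp,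
        ENNReal.ofReal_mul h5, ENNReal.ofReal_pow (by positivity), ENNReal.ofReal_mul h4,
        ENNReal.ofReal_pow h3])
    (ENNReal.ofReal (η * n))
    (ENNReal.ofReal (Real.exp (-(q2 * N * (1 - s2))) / s2 ^ (ρ * d)))
    (ENNReal.ofReal (Real.exp (-(p1 * ((1 - κ) * N) * (1 - s1))) / s1 ^ (ρ * d)))
    (by simp; positivity) (by simp)
    (by
      intro v
      have := chernoff q2 hq20 hq2 s2 hs2 hs2' (starE r n v) (ρ * d)
      rw [card_starE r n hr v] at this
      rw [hcJ]; exact this)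
    (by
      intro b hb v hv
      have := hAc b hb v hv
      rw [← Finset.card_pos]
      have h : (0:ℝ) < (1 - κ) * N := by
        apply mul_pos _ hN0; linarith
      have h' := h.trans_le this
      convert (by exact_mod_cast h' : 0 < ((starE r n v).filter (fun e => ownerE r n b e = v)).card))
    (by
      intro b hb v hv
      have h4 := hAc b hb v hv
      rw [hcJ]
      refine (chernoff p1 hp10 hp1 s1 hs1 hs1' _ (ρ * d)).trans ?_
      apply ENNReal.ofReal_le_ofReal
      have h5 : 0 ≤ 1 - s1 := by linarith
      gcongr
      exact h4.trans (le_of_eq (by congr!)))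
    (by
      intro b hb v hv
      refine q3_lemma (starE r n v) _ N (card_starE r n hr v) hN (sdiff_sub_cl _ _) ?_
      have h4 := hexc b hb v hv
      have h5 : (2:ℝ) * ((starE r n v \ (starE r n v).filter (fun e => ownerE r n b e = v)).card : ℝ) ≤ N := by
        nlinarith
      convert (by exact_mod_cast h5 : 2 * (starE r n v \ (starE r n v).filter (fun e => ownerE r n b e = v)).card ≤ N))
  have hS : ∀ v : Fin n, Nonempty {e : Finset (Fin n) // e.card = r ∧ v ∈ e} := by
    intro v
    obtain ⟨e, he⟩ := hne v
    exact ⟨⟨e.1, e.2, (mem_starE _ _ _ _).1 he⟩⟩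
  let c := convP r n ρ d hS
  have hd : DiscreteMeasurableSpace ((Edge r n → Bool) × (Fin n → Fin ρ × Fin d → Edge r n)) :=
    inferInstance
  refine ⟨π.map (fun z => (z.1, c z.2)), ?_, ?_, ?_⟩
  · rw [Measure.map_map .of_discrete .of_discrete, ← h1]; rfl
  · rw [Measure.map_map .of_discrete .of_discrete, ← conv_law r n ρ d hr hn hS, ← h2,
      Measure.map_map .of_discrete .of_discrete]
    rfl
  · rw [Measure.map_apply .of_discrete .of_discrete]
    have hsub : (fun z : (Edge r n → Bool) × (Fin n → Fin ρ × Fin d → Edge r n) => (z.1, c z.2)) ⁻¹'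
        {ω | ¬ ∀ (i : Fin ρ) (v : Fin n) (j : Fin d),
                ω.1 ⟨(ω.2 i v j).1, (ω.2 i v j).2.1⟩ = true} ⊆
        {z | ¬ ∀ v j, z.1 (z.2 v j) = true} ∪ Prod.snd ⁻¹' {f | ¬ ∀ v j, v ∈ (f v j).1} := by
      intro z hz
      by_contra hcon
      rw [Set.mem_union, not_or] at hcon
      simp only [Set.mem_preimage, Set.mem_setOf_eq, not_not] at hcon
      apply hz
      intro i v j
      have k1 := hcon.1 v (i, j)
      have k2 := hcon.2 v (i, j)
      simp only [c, convP, k2, dif_pos]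
      exact k1
    refine (measure_mono hsub).trans ((measure_union_le _ _).trans ?_)
    have : π (Prod.snd ⁻¹' {f | ¬ ∀ v j, v ∈ (f v j).1}) = 0 := by
      rw [← Measure.map_apply .of_discrete .of_discrete, h2, null_off r n ρ d hr hn]
    rw [this, add_zero]
    refine h3.trans (le_of_eq ?_)
    rw [Fintype.card_fin, ENNReal.ofReal_add (by positivity) (by positivity),
      ENNReal.ofReal_mul (p := (n:ℝ)) (by positivity), ENNReal.ofReal_natCast]
    congr 1
    rw [← ENNReal.ofReal_natCast, ← ENNReal.ofReal_mul (by positivity),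
      ← ENNReal.ofReal_div_of_pos (by positivity)]
    congr 1
    field_simp

end Part9

section Part10

lemma Qr_bound (q2 q3 : ℝ) (m r : ℕ) (h2 : 0 ≤ q2) (h2' : q2 ≤ 1) (h3 : 0 ≤ q3) (h3' : q3 ≤ 1)
    (hu : q2 + m * q3 ≤ 1) :
    1 - r * (q2 + m * q3) ≤ ((1 - q2) * (1 - q3) ^ m) ^ r := by
  have a1 : 1 - m * q3 ≤ (1 - q3) ^ m := by
    have := one_add_mul_le_pow (a := -q3) (by linarith) m
    have e : 1 + -q3 = 1 - q3 := by ring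
    rw [e] at this; linarith
  have a2 : 1 - (q2 + m * q3) ≤ (1 - q2) * (1 - q3) ^ m := by
    have : (1 - q2) * (1 - m * q3) ≤ (1 - q2) * (1 - q3) ^ m := by
      apply mul_le_mul_of_nonneg_left a1; linarith
    have : 0 ≤ q2 * (m * q3) := by positivity
    nlinarith
  have a3 : 1 - r * (q2 + m * q3) ≤ (1 - (q2 + m * q3)) ^ r := by
    have := one_add_mul_le_pow (a := -(q2 + m * q3)) (by linarith) r
    have e : 1 + -(q2 + m * q3) = 1 - (q2 + m * q3) := by ring
    rw [e] at this; linarith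
  exact a3.trans (pow_le_pow_left₀ (by linarith) a2 _)

lemma log_small (ε : ℝ) (ρ : ℕ) (hρ : 1 ≤ ρ) (h0 : 0 < ε) (h1 : ε ≤ 1 / (4096 * ρ ^ 2)) :
    ρ * ε * Real.log (16 / ε) ≤ 1 / 8 := by
  have hρ0 : (0:ℝ) < ρ := by exact_mod_cast hρ
  obtain ⟨σ, hσ, rfl⟩ : ∃ σ : ℝ, 0 < σ ∧ ε = σ ^ 2 :=
    ⟨√ε, Real.sqrt_pos.2 h0, (Real.sq_sqrt h0.le).symm⟩
  have e : (16:ℝ) / σ ^ 2 = (4 / σ) ^ 2 := by field_simp; norm_num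
  have h2 : σ ≤ 1 / (64 * ρ) := by
    apply (pow_le_pow_iff_left₀ hσ.le (by positivity) two_ne_zero).1
    refine h1.trans (le_of_eq ?_)
    field_simp; norm_num
  have h3 : Real.log (4 / σ) ≤ 4 / σ := by
    have := Real.log_le_sub_one_of_pos (x := 4 / σ) (by positivity)
    linarith
  rw [e, Real.log_pow]
  push_cast
  calc ρ * σ ^ 2 * (2 * Real.log (4 / σ)) ≤ ρ * σ ^ 2 * (2 * (4 / σ)) := by gcongr
    _ = 8 * ρ * σ := by field_simp; norm_num
    _ ≤ 8 * ρ * (1 / (64 * ρ)) := by gcongr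
    _ = 1 / 8 := by field_simp; norm_num

set_option maxHeartbeats 2000000 in
lemma params (r n ρ : ℕ) (hr : 3 ≤ r) (hρ : 1 ≤ ρ) (hn : r ≤ n) (ε : ℝ) (h0 : 0 < ε)
    (h1 : ε ≤ 1 / (4096 * r * ρ ^ 2)) (hN : 2 ≤ (n - 1).choose (r - 1))
    (hl : 2 * r * ρ ≤ ε / 8 * Real.log n) (hl2 : 2 * Real.log n ≤ (n - 1).choose (r - 1)) :
    ∃ π : Measure ((Edge r n → Bool) × (Fin ρ → Picks r n ⌈ε ^ 2 * Real.log n⌉₊)),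
      π.map Prod.fst = Measure.pi (fun _ : Edge r n => bern (ENNReal.ofReal
                  (min ((1 + ε) * Real.log n / ((n - 1).choose (r - 1))) 1))) ∧
      π.map Prod.snd = Measure.pi (fun _ : Fin ρ => uniformPicks r n ⌈ε ^ 2 * Real.log n⌉₊) ∧
      π {ω | ¬ ∀ (i : Fin ρ) (v : Fin n) (j : Fin ⌈ε ^ 2 * Real.log n⌉₊),
                ω.1 ⟨(ω.2 i v j).1, (ω.2 i v j).2.1⟩ = true} ≤
        ENNReal.ofReal
          (Real.exp ρ / (ε / (32 * r)) * Real.exp (-(ε / (16 * r) * Real.log n)) +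
            Real.exp (ρ * Real.log (16 / ε)) * Real.exp (-(ε / 8 * Real.log n))) := by
  set N := (n - 1).choose (r - 1) with hNdef
  set l := Real.log n with hldef
  set d := ⌈ε ^ 2 * l⌉₊ with hd
  have hr0 : (3:ℝ) ≤ r := by exact_mod_cast hr
  have hρ0 : (1:ℝ) ≤ ρ := by exact_mod_cast hρ
  have hrρ : (0:ℝ) < 4096 * r * ρ ^ 2 := by positivity
  have hN2 : (2:ℝ) ≤ N := by exact_mod_cast hN
  have hN0 : (0:ℝ) < N := by linarith
  have hl0 : 0 < l := by
    have : 0 < 2 * (r:ℝ) * ρ := by positivity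
    by_contra hcon
    push Not at hcon
    nlinarith
  have hε' : ε * (4096 * r * ρ ^ 2) ≤ 1 := by rwa [le_div_iff₀ hrρ] at h1
  have hρ2 : (ρ:ℝ) ≤ ρ ^ 2 := by nlinarith
  have hε1 : ε * (r * ρ) ≤ 1 / 4096 := by
    have : ε * (r * ρ) ≤ ε * (r * ρ ^ 2) := by gcongr
    linarith
  have hε2 : ε ≤ 1 / 4096 := by
    have : ε * 1 ≤ ε * (r * ρ) := by
      apply mul_le_mul_of_nonneg_left _ h0.le; nlinarith
    linarith
  have hε3 : ε ≤ 1 / (4096 * ρ ^ 2) := by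
    refine h1.trans ?_
    apply one_div_le_one_div_of_le (by positivity)
    have : (0:ℝ) ≤ ρ ^ 2 := by positivity
    nlinarith
  have hdle : (d:ℝ) ≤ ε ^ 2 * l + 1 := (Nat.ceil_lt_add_one (by positivity)).le
  have hm : ((ρ * d : ℕ) : ℝ) ≤ ρ * ε ^ 2 * l + ρ := by
    push_cast
    have : (ρ:ℝ) * d ≤ ρ * (ε ^ 2 * l + 1) := by gcongr
    linarith
  set m := ρ * d with hmdef
  set x := l / N with hx
  have hx0 : 0 < x := by positivity
  have hxN : x * N = l := by rw [hx]; field_simp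
  have hx2 : 2 * x ≤ 1 := by
    rw [hx, ← mul_div_assoc, div_le_one hN0]; exact hl2
  set p := (1 + ε) * x with hp
  have hpeq : (1 + ε) * l / N = p := by rw [hp, hx]; ring
  have hp0 : 0 ≤ p := by positivity
  have hp1 : p ≤ 1 := by rw [hp]; nlinarith
  set q2 := ε / (4 * r) * x with hq2
  have hq20 : 0 ≤ q2 := by positivity
  have hrq2 : r * q2 = ε / 4 * x := by rw [hq2]; field_simp
  set q3 := 2 / (N:ℝ) with hq3
  have hq30 : 0 ≤ q3 := by positivity
  have hq31 : q3 ≤ 1 := by rw [hq3, div_le_one hN0]; exact hN2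
  have hrm : r * (m * q3) ≤ ε / 4 * x := by
    have e1 : r * (m * q3) = 2 * r * m / N := by rw [hq3]; ring
    have e2 : ε / 4 * x = (ε / 4 * l) / N := by rw [hx]; ring
    rw [e1, e2]
    apply div_le_div_of_nonneg_right _ hN0.le
    have : 2 * (r:ℝ) * m ≤ 2 * r * (ρ * ε ^ 2 * l + ρ) := by gcongr
    have h5 : 2 * (r:ℝ) * (ρ * ε ^ 2 * l) ≤ ε / 8 * l := by
      have : ε * (ε * (r * ρ)) * l ≤ ε * (1 / 4096) * l := by gcongr
      nlinarith
    linarith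
  have hru : r * (q2 + m * q3) ≤ ε / 2 * x := by linarith
  have hu0 : 0 ≤ q2 + m * q3 := by positivity
  have hru1 : r * (q2 + m * q3) < 1 / 2 := by
    refine hru.trans_lt ?_
    nlinarith
  have hu1 : q2 + m * q3 ≤ 1 := by nlinarith
  have hq21 : q2 ≤ 1 := by
    have : 0 ≤ m * q3 := by positivity
    linarith
  have hQ := Qr_bound q2 q3 m r hq20 hq21 hq30 hq31 hu1
  set Qr := ((1 - q2) * (1 - q3) ^ m) ^ r with hQr
  have hQ0 : 0 < Qr := by linarith
  set p1 := 1 - (1 - p) / Qr with hp1def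
  have hp11 : p1 ≤ 1 := by
    have : 0 ≤ (1 - p) / Qr := div_nonneg (by linarith) hQ0.le
    linarith
  have hp1low : (1 + ε / 2) * x ≤ p1 := by
    have : (1 - p) / Qr ≤ 1 - (1 + ε / 2) * x := by
      rw [div_le_iff₀ hQ0]
      have h6 : 0 ≤ 1 - (1 + ε / 2) * x := by nlinarith
      have h7 : 1 - ε / 2 * x ≤ Qr := by linarith
      have h8 := mul_le_mul_of_nonneg_left h7 h6
      have h9 : 0 ≤ (1 + ε / 2) * x * (ε / 2 * x) := by positivity
      rw [hp]
      nlinarith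
    linarith
  have hp10 : 0 ≤ p1 := le_trans (by positivity) hp1low
  have hpp : (1 - p1) * ((1 - q2) * (1 - 2 / ((n - 1).choose (r - 1) : ℕ)) ^ (ρ * d)) ^ r = 1 - p := by
    have : (1 - p1) * Qr = 1 - p := by
      rw [hp1def]; field_simp; ring
    exact this
  obtain ⟨π, k1, k2, k3⟩ := graphThm r n ρ d (by omega) hn p p1 q2 (ε / (32 * r)) (ε / 16) (ε / 16) (1 / 2)
    hp0 hp1 hp10 hp11 hq20 hq21 hN hpp (by positivity)
    (by apply le_of_eq; field_simp; norm_num) (by linarith) (by positivity) (by linarith) (by norm_num) (by norm_num)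
  refine ⟨π, ?_, k2, k3.trans ?_⟩
  · rw [k1, hpeq, min_eq_left hp1]
  apply ENNReal.ofReal_le_ofReal
  have hnn : (0:ℝ) < n := by
    have : 0 < n := by omega
    exact_mod_cast this
  have hn_exp : (n:ℝ) = Real.exp l := (Real.exp_log hnn).symm
  apply add_le_add
  · rw [div_mul_eq_mul_div]
    apply div_le_div_of_nonneg_right _ (by positivity)
    have e1 : Real.exp (-(q2 * N * (1 - 1 / 2))) / (1 / 2 : ℝ) ^ (ρ * d) =
        Real.exp (-(q2 * N * (1 - 1 / 2))) * 2 ^ m := by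
      rw [one_div, inv_pow, div_inv_eq_mul]
    rw [e1]
    have e2 : (2:ℝ) ^ m ≤ Real.exp m := by
      have : (2:ℝ) ≤ Real.exp 1 := by have := Real.add_one_le_exp (1:ℝ); linarith
      calc (2:ℝ) ^ m ≤ (Real.exp 1) ^ m := by gcongr
        _ = Real.exp m := by rw [← Real.exp_nat_mul, mul_one]
    calc Real.exp (-(q2 * N * (1 - 1 / 2))) * 2 ^ m ≤ Real.exp (-(q2 * N * (1 - 1 / 2))) * Real.exp m := by gcongr
      _ = Real.exp (-(q2 * N * (1 - 1 / 2)) + m) := by rw [Real.exp_add]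
      _ ≤ Real.exp (ρ + -(ε / (16 * r) * l)) := by
          apply Real.exp_le_exp.2
          have e3 : q2 * N * (1 - 1 / 2) = 2 * (ε / (16 * r) * l) := by
            rw [← hxN, hq2]; field_simp; norm_num
          have e4 : ρ * ε ^ 2 * l ≤ ε / (16 * r) * l := by
            apply mul_le_mul_of_nonneg_right _ hl0.le
            rw [le_div_iff₀ (by positivity)]
            nlinarith
          rw [e3]; linarith
      _ = _ := Real.exp_add _ _
  · set Λ := Real.log (16 / ε) with hΛ
    have hΛ0 : 0 ≤ Λ := Real.log_nonneg (by rw [le_div_iff₀ h0]; linarith)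
    have e1 : ((ε / 16) ^ (ρ * d))⁻¹ = Real.exp (m * Λ) := by
      rw [Real.exp_nat_mul, hΛ, Real.exp_log (by positivity), ← inv_pow, inv_div]
    rw [div_eq_mul_inv, e1, hn_exp, ← Real.exp_add, ← Real.exp_add, ← Real.exp_add]
    apply Real.exp_le_exp.2
    have e2 : m * Λ ≤ ρ * ε ^ 2 * l * Λ + ρ * Λ := by
      have := mul_le_mul_of_nonneg_right hm hΛ0
      linarith
    have e3 : ρ * ε ^ 2 * l * Λ ≤ ε / 8 * l := by
      have := log_small ε ρ hρ h0 hε3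
      have h5 : 0 ≤ ε * l := by positivity
      have := mul_le_mul_of_nonneg_left this h5
      rw [← hΛ] at this
      nlinarith
    have e4 : (1 + ε / 4) * l ≤ p1 * ((1 - ε / 16) * N) * (1 - ε / 16) := by
      have a1 : (1 + ε / 2) * x * ((1 - ε / 16) * N) * (1 - ε / 16) ≤
          p1 * ((1 - ε / 16) * N) * (1 - ε / 16) := by
        have : 0 ≤ 1 - ε / 16 := by linarith
        gcongr
      have a2 : (1 + ε / 2) * x * ((1 - ε / 16) * N) * (1 - ε / 16) =
        (1 + ε / 2) * (1 - ε / 16) ^ 2 * l := by rw [← hxN]; ring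
      rw [a2] at a1
      refine le_trans ?_ a1
      apply mul_le_mul_of_nonneg_right _ hl0.le
      have : 0 ≤ ε ^ 3 := by positivity
      nlinarith
    linarith

end Part10

section Part11

lemma N_lower (r n : ℕ) (hr : 3 ≤ r) (hn : r ≤ n) : (n:ℝ) - 1 ≤ (n - 1).choose (r - 1) * r := by
  have h := choose_rel r n (by omega) hn
  have h1 : 1 ≤ (n - 2).choose (r - 2) := Nat.choose_pos (by omega)
  have h2 : n - 1 ≤ (n - 1).choose (r - 1) * r := by
    calc n - 1 ≤ (n - 1) * (n - 2).choose (r - 2) := Nat.le_mul_of_pos_right _ h1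
      _ = _ := h
      _ ≤ _ := Nat.mul_le_mul_left _ (by omega)
  have h3 : ((n - 1 : ℕ) : ℝ) ≤ (n - 1).choose (r - 1) * r := by exact_mod_cast h2
  rwa [Nat.cast_sub (by omega), Nat.cast_one] at h3

lemma eventually_good (r ρ : ℕ) (hr : 3 ≤ r) (ε : ℝ) (h0 : 0 < ε) :
    ∀ᶠ n : ℕ in Filter.atTop, r ≤ n ∧ 2 ≤ (n - 1).choose (r - 1) ∧
      2 * r * ρ ≤ ε / 8 * Real.log n ∧ 2 * Real.log n ≤ (n - 1).choose (r - 1) := by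
  have hr0 : (3:ℝ) ≤ r := by exact_mod_cast hr
  have hlog : Filter.Tendsto (fun n : ℕ => Real.log n) Filter.atTop Filter.atTop :=
    Real.tendsto_log_atTop.comp tendsto_natCast_atTop_atTop
  have e1 := hlog.eventually_ge_atTop (2 * r * ρ / (ε / 8))
  have e2 : ∀ᶠ n : ℕ in Filter.atTop, |Real.log n| ≤ 1 / (4 * r) * |(n:ℝ)| := by
    have := (Real.isLittleO_log_id_atTop.comp_tendsto
      (tendsto_natCast_atTop_atTop (R := ℝ))).def (c := 1 / (4 * r)) (by positivity)
    simpa using this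
  filter_upwards [e1, e2, Filter.eventually_ge_atTop (max r (2 * r + 2))] with n h1 h2 h3
  have h4 : r ≤ n := le_trans (le_max_left _ _) h3
  have h5 : 2 * r + 2 ≤ n := le_trans (le_max_right _ _) h3
  have h5' : 2 * (r:ℝ) + 2 ≤ n := by exact_mod_cast h5
  have hN := N_lower r n hr h4
  set N := (n - 1).choose (r - 1)
  refine ⟨h4, ?_, ?_, ?_⟩
  · have : (2:ℝ) * r ≤ N * r := by linarith
    have : (2:ℝ) ≤ N := le_of_mul_le_mul_right this (by linarith)
    exact_mod_cast this
  · rw [div_le_iff₀ (by positivity)] at h1; linarith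
  · have h6 : Real.log n ≤ 1 / (4 * r) * n := by
      have := (le_abs_self _).trans h2
      rwa [abs_of_nonneg (by positivity : (0:ℝ) ≤ n)] at this
    have h7 : 2 * Real.log n * r ≤ n / 2 := by
      have : 2 * Real.log n * r ≤ 2 * (1 / (4 * r) * n) * r := by gcongr
      refine this.trans (le_of_eq ?_)
      field_simp; norm_num
    have : 2 * Real.log n * r ≤ N * r := by linarith
    exact le_of_mul_le_mul_right this (by linarith)

end Part11

/-- Let `r ≥ 3`, let `ρ ≥ 1` be a fixed integer, let `ε > 0` be a
sufficiently small constant, and set `d* = ⌈ε² log n⌉` and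
`p = (1+ε) log n / C(n-1,r-1)`.  Then for each `n` there is a probability space—
equivalently, a joint law `μ n` on the product of the outcome spaces—carrying random
hypergraphs `H, Γ̂_1, …, Γ̂_ρ` on `Fin n` such that:
* `H` (the first coordinate, an indicator function of the set of `r`-subsets present)
  is distributed as `H_{n,p}` (each edge present independently with probability `p`;
  the probability is truncated at `1`, which only affects finitely many `n`);
* `Γ̂_1, …, Γ̂_ρ` (the second coordinate) are mutually independent, each distributed as
  `Ĥ_{n,d*}` (their joint law is the `ρ`-fold product of `uniformPicks`);
* the probability that every edge picked in every `Γ̂_i` is an edge of `H` tends to `1`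
  as `n → ∞`.
(The distributional requirements are imposed for `n ≥ r`, since for `n < r` the outcome
space of `Ĥ_{n,d}` with `d ≥ 1` is empty and carries no probability measure.) -/
theorem stmt_3 (r : ℕ) (hr : 3 ≤ r) (ρ : ℕ) (hρ : 1 ≤ ρ) :
    ∃ ε₀ : ℝ, 0 < ε₀ ∧ ∀ ε : ℝ, 0 < ε → ε ≤ ε₀ →
      ∃ μ : ∀ n : ℕ,
          Measure ((Edge r n → Bool) × (Fin ρ → Picks r n ⌈ε ^ 2 * Real.log n⌉₊)),
        (∀ n : ℕ, r ≤ n → IsProbabilityMeasure (μ n)) ∧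
        (∀ n : ℕ, r ≤ n →
          (μ n).map Prod.fst
            = Measure.pi (fun _ : Edge r n =>
                bern (ENNReal.ofReal
                  (min ((1 + ε) * Real.log n / ((n - 1).choose (r - 1))) 1)))) ∧
        (∀ n : ℕ, r ≤ n →
          (μ n).map Prod.snd
            = Measure.pi (fun _ : Fin ρ => uniformPicks r n ⌈ε ^ 2 * Real.log n⌉₊)) ∧
        Filter.Tendsto
          (fun n : ℕ =>
            μ n {ω | ∀ (i : Fin ρ) (v : Fin n) (j : Fin ⌈ε ^ 2 * Real.log n⌉₊),
                ω.1 ⟨(ω.2 i v j).1, (ω.2 i v j).2.1⟩ = true})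
          Filter.atTop (nhds 1) := by
  have hr0 : (3:ℝ) ≤ r := by exact_mod_cast hr
  have hρ0 : (1:ℝ) ≤ ρ := by exact_mod_cast hρ
  refine ⟨1 / (4096 * r * ρ ^ 2), by positivity, fun ε h0 h1 => ?_⟩
  let bad : ∀ n : ℕ, Set ((Edge r n → Bool) × (Fin ρ → Picks r n ⌈ε ^ 2 * Real.log n⌉₊)) := fun n =>
    {ω | ¬ ∀ (i : Fin ρ) (v : Fin n) (j : Fin ⌈ε ^ 2 * Real.log n⌉₊),
                ω.1 ⟨(ω.2 i v j).1, (ω.2 i v j).2.1⟩ = true}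
  let F : ℕ → ℝ := fun n =>
    Real.exp ρ / (ε / (32 * r)) * Real.exp (-(ε / (16 * r) * Real.log n)) +
            Real.exp (ρ * Real.log (16 / ε)) * Real.exp (-(ε / 8 * Real.log n))
  have hex : ∀ n : ℕ, ∃ μ : Measure ((Edge r n → Bool) × (Fin ρ → Picks r n ⌈ε ^ 2 * Real.log n⌉₊)),
      (r ≤ n → IsProbabilityMeasure μ ∧
        μ.map Prod.fst = Measure.pi (fun _ : Edge r n =>
                bern (ENNReal.ofReal
                  (min ((1 + ε) * Real.log n / ((n - 1).choose (r - 1))) 1))) ∧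
        μ.map Prod.snd = Measure.pi (fun _ : Fin ρ => uniformPicks r n ⌈ε ^ 2 * Real.log n⌉₊)) ∧
      ((r ≤ n ∧ 2 ≤ (n - 1).choose (r - 1) ∧
      2 * r * ρ ≤ ε / 8 * Real.log n ∧ 2 * Real.log n ≤ (n - 1).choose (r - 1)) →
        μ (bad n) ≤ ENNReal.ofReal (F n)) := by
    intro n
    have hb := bern_prob (ENNReal.ofReal
        (min ((1 + ε) * Real.log n / ((n - 1).choose (r - 1))) 1)) (by simp)
    by_cases hg : r ≤ n ∧ 2 ≤ (n - 1).choose (r - 1) ∧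
      2 * r * ρ ≤ ε / 8 * Real.log n ∧ 2 * Real.log n ≤ (n - 1).choose (r - 1)
    · obtain ⟨g1, g2, g3, g4⟩ := hg
      obtain ⟨π, k1, k2, k3⟩ := params r n ρ hr hρ g1 ε h0 h1 g2 g3 g4
      refine ⟨π, fun _ => ⟨?_, k1, k2⟩, fun _ => k3⟩
      have : IsProbabilityMeasure (π.map Prod.fst) := by rw [k1]; infer_instance
      constructor
      have h := this.measure_univ
      rwa [Measure.map_apply measurable_fst .univ, Set.preimage_univ] at h
    · by_cases hn : r ≤ n
      · have hp := picks_prob r n ⌈ε ^ 2 * Real.log n⌉₊ (by omega) hn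
        refine ⟨(Measure.pi (fun _ : Edge r n =>
                bern (ENNReal.ofReal
                  (min ((1 + ε) * Real.log n / ((n - 1).choose (r - 1))) 1)))).prod
            (Measure.pi (fun _ : Fin ρ => uniformPicks r n ⌈ε ^ 2 * Real.log n⌉₊)),
          fun _ => ⟨inferInstance, ?_, ?_⟩, fun h => absurd h hg⟩
        · rw [Measure.map_fst_prod, measure_univ, one_smul]
        · rw [Measure.map_snd_prod, measure_univ, one_smul]
      · exact ⟨0, fun h => absurd h hn, fun h => absurd h hg⟩
  choose μ hμ1 hμ2 using hex
  refine ⟨μ, fun n hn => (hμ1 n hn).1, fun n hn => (hμ1 n hn).2.1, fun n hn => (hμ1 n hn).2.2, ?_⟩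
  have hlog : Filter.Tendsto (fun n : ℕ => Real.log n) Filter.atTop Filter.atTop :=
    Real.tendsto_log_atTop.comp tendsto_natCast_atTop_atTop
  have hexp : ∀ c : ℝ, 0 < c → Filter.Tendsto (fun n : ℕ => Real.exp (-(c * Real.log n)))
      Filter.atTop (nhds 0) := fun c hc =>
    Real.tendsto_exp_neg_atTop_nhds_zero.comp (hlog.const_mul_atTop hc)
  have hF : Filter.Tendsto F Filter.atTop (nhds 0) := by
    have := ((hexp (ε / (16 * r)) (by positivity)).const_mul (Real.exp ρ / (ε / (32 * r)))).add
      ((hexp (ε / 8) (by positivity)).const_mul (Real.exp (ρ * Real.log (16 / ε))))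
    simpa using this
  have hF' : Filter.Tendsto (fun n => ENNReal.ofReal (F n)) Filter.atTop (nhds 0) := by
    have := ENNReal.tendsto_ofReal hF
    simpa using this
  have hlow : Filter.Tendsto (fun n => 1 - ENNReal.ofReal (F n)) Filter.atTop (nhds 1) := by
    have := ENNReal.Tendsto.sub (tendsto_const_nhds (x := (1:ℝ≥0∞)) (f := Filter.atTop (α := ℕ))) hF'
      (Or.inl ENNReal.one_ne_top)
    simpa using this
  refine tendsto_of_tendsto_of_tendsto_of_le_of_le' hlow tendsto_const_nhds ?_ ?_
  · filter_upwards [eventually_good r ρ hr ε h0] with n hn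
    have := (hμ1 n hn.1).1
    have hd : DiscreteMeasurableSpace ((Edge r n → Bool) × (Fin ρ → Picks r n ⌈ε ^ 2 * Real.log n⌉₊)) :=
      inferInstance
    have hc : {ω : (Edge r n → Bool) × (Fin ρ → Picks r n ⌈ε ^ 2 * Real.log n⌉₊) |
        ∀ (i : Fin ρ) (v : Fin n) (j : Fin ⌈ε ^ 2 * Real.log n⌉₊),
                ω.1 ⟨(ω.2 i v j).1, (ω.2 i v j).2.1⟩ = true} = (bad n)ᶜ := by
      ext ω; simp only [bad, Set.mem_setOf_eq, Set.mem_compl_iff, not_not]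
    rw [hc, prob_compl_eq_one_sub .of_discrete]
    exact tsub_le_tsub_left (hμ2 n hn) 1
  · filter_upwards [eventually_good r ρ hr ε h0] with n hn
    have := (hμ1 n hn.1).1
    exact prob_le_one
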